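/- A finite extension of a fully Hilbertian field is fully Hilbertian. -/

import Mathlib

open Polynomial

/-- The Hilbert set of `f(X,Y) ∈ K[X][Y]` (with `Y` the outer variable). -/
def HilbertSet {K : Type} [Field K] (f : Polynomial (Polynomial K)) : Set K :=
  {a : K | Irreducible (f.map (Polynomial.evalRingHom a))}

/-- `K` is fully Hilbertian (equivalent characterization by absolutely irreducible
polynomials): for every absolutely irreducible `f(X,Y) ∈ K[X,Y]` separable in `Y` there
are `|K|` many `a ∈ H(f)` and roots `b_a` of `f(a,Y)` such that the fields `K(b_a)` are
linearly disjoint over `K`. -/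
def IsFullyHilbertian (K : Type) [Field K] : Prop :=
  ∀ f : Polynomial (Polynomial K),
    Irreducible (f.map (Polynomial.mapRingHom (algebraMap K (AlgebraicClosure K)))) →
    f.derivative ≠ 0 →
    ∃ (A : Set K) (b : A → AlgebraicClosure K),
      A ⊆ HilbertSet f ∧ Cardinal.mk A = Cardinal.mk K ∧
      (∀ a : A, Polynomial.aeval (b a) (f.map (Polynomial.evalRingHom (a : K))) = 0) ∧
      (∀ a : A,
        (IntermediateField.adjoin K {b a}).LinearDisjoint
          ↥(⨆ (a' : A) (_ : a' ≠ a), IntermediateField.adjoin K {b a'}))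

open IntermediateField in
theorem finrank_sup_mul_finrank_le {K C : Type*} [Field K] [Field C] [Algebra K C]
    (U M M' : IntermediateField K C) [FiniteDimensional K U] [FiniteDimensional K M]
    [FiniteDimensional K M'] (h : M ≤ M') :
    Module.finrank K ↥(U ⊔ M') * Module.finrank K M ≤
      Module.finrank K ↥(U ⊔ M) * Module.finrank K M' := by
  have hU : M ≤ U ⊔ M := le_sup_right
  have hle := finrank_sup_le (extendScalars h) (extendScalars hU)
  have e : U ⊔ M' = (extendScalars h ⊔ extendScalars hU).restrictScalars K := by
    rw [extendScalars_sup, extendScalars_restrictScalars]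
    apply le_antisymm
    · exact sup_le (le_sup_of_le_right le_sup_left) le_sup_left
    · exact sup_le le_sup_right (sup_le_sup_left h U)
  have : Module.Free M ↥(extendScalars h ⊔ extendScalars hU) := Module.Free.of_divisionRing _ _
  have : Module.Free M (extendScalars h) := Module.Free.of_divisionRing _ _
  have : Module.Free M (extendScalars hU) := Module.Free.of_divisionRing _ _
  have h1 : Module.finrank K ↥(U ⊔ M') = Module.finrank K M *
      Module.finrank M ↥(extendScalars h ⊔ extendScalars hU) := by
    rw [e]; exact (Module.finrank_mul_finrank K M ↥(extendScalars h ⊔ extendScalars hU)).symm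
  have h2 : Module.finrank K M' = Module.finrank K M * Module.finrank M (extendScalars h) :=
    (Module.finrank_mul_finrank K M (extendScalars h)).symm
  have h3 : Module.finrank K ↥(U ⊔ M) = Module.finrank K M * Module.finrank M (extendScalars hU) :=
    (Module.finrank_mul_finrank K M (extendScalars hU)).symm
  rw [h1, h2, h3]
  calc _ ≤ Module.finrank K M * (Module.finrank M (extendScalars h) *
            Module.finrank M (extendScalars hU)) * Module.finrank K M := by gcongr
    _ = _ := by ring

open IntermediateField in
theorem exists_finset_finrank_sup_eq {K C ι : Type*} [Field K] [Field C] [Algebra K C]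
    [Algebra.IsAlgebraic K C] (U : IntermediateField K C) [FiniteDimensional K U] (c : ι → C)
    (hc : ∀ a, (K⟮c a⟯).LinearDisjoint (adjoin K (c '' {a' | a' ≠ a}))) :
    ∃ S : Finset ι, ∀ T : Finset ι, S ⊆ T → ∀ a ∉ T,
      Module.finrank K ↥(U ⊔ adjoin K (c '' (insert a (T : Set ι)))) =
        Module.finrank K ↥(U ⊔ adjoin K (c '' (T : Set ι))) * Module.finrank K K⟮c a⟯ := by
  classical
  have hfin (T : Set ι) (hT : T.Finite) : FiniteDimensional K (adjoin K (c '' T)) := by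
    have := (hT.image c).to_subtype
    exact finiteDimensional_adjoin fun x _ ↦ (Algebra.IsAlgebraic.isAlgebraic x).isIntegral
  have hdvd (T : Finset ι) : Module.finrank K (adjoin K (c '' (T : Set ι))) ∣
      Module.finrank K ↥(U ⊔ adjoin K (c '' (T : Set ι))) :=
    finrank_dvd_of_le_right le_sup_right
  let ρ : Finset ι → ℕ := fun T ↦ Module.finrank K ↥(U ⊔ adjoin K (c '' (T : Set ι))) /
    Module.finrank K (adjoin K (c '' (T : Set ι)))
  have hρ (T : Finset ι) : Module.finrank K ↥(U ⊔ adjoin K (c '' (T : Set ι))) =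
      ρ T * Module.finrank K (adjoin K (c '' (T : Set ι))) := (Nat.div_mul_cancel (hdvd T)).symm
  have hanti (T T' : Finset ι) (h : T ⊆ T') : ρ T' ≤ ρ T := by
    have := hfin T T.finite_toSet
    have := hfin T' T'.finite_toSet
    have h1 := finrank_sup_mul_finrank_le U (adjoin K (c '' (T : Set ι)))
      (adjoin K (c '' (T' : Set ι))) (adjoin.mono _ _ _ (Set.image_mono (by exact_mod_cast h)))
    rw [hρ T, hρ T'] at h1
    have p1 : 0 < Module.finrank K (adjoin K (c '' (T : Set ι))) := Module.finrank_pos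
    have p2 : 0 < Module.finrank K (adjoin K (c '' (T' : Set ι))) := Module.finrank_pos
    refine Nat.le_of_mul_le_mul_right (c := Module.finrank K (adjoin K (c '' (T : Set ι))) *
      Module.finrank K (adjoin K (c '' (T' : Set ι)))) ?_ (by positivity)
    linarith
  obtain ⟨S, hS⟩ : ∃ S, ∀ T, ρ S ≤ ρ T := by
    have := (Set.range_nonempty ρ)
    obtain ⟨S, hS⟩ := Nat.sInf_mem this
    exact ⟨S, fun T ↦ hS ▸ Nat.sInf_le ⟨T, rfl⟩⟩
  refine ⟨S, fun T hT a ha ↦ ?_⟩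
  have e1 : ρ T = ρ S := le_antisymm (hanti _ _ hT) (hS T)
  have e2 : ρ (insert a T) = ρ S :=
    le_antisymm (hanti _ _ (hT.trans (Finset.subset_insert a T))) (hS _)
  have h1 := hρ (insert a T)
  rw [e2, Finset.coe_insert] at h1
  rw [h1, hρ T, e1]
  have hd : (K⟮c a⟯).LinearDisjoint (adjoin K (c '' (T : Set ι))) :=
    (hc a).of_le_right (adjoin.mono _ _ _ (Set.image_mono fun x hx hxa ↦ ha (hxa ▸ hx)))
  have := hd.finrank_sup
  rw [Set.image_insert_eq, Set.insert_eq, adjoin_union, this]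
  ring

open IntermediateField in
theorem exists_finset_linearDisjoint_of_finiteDimensional {K L C ι : Type*} [Field K] [Field L]
    [Field C] [Algebra K L] [Algebra L C] [Algebra K C] [IsScalarTower K L C]
    [FiniteDimensional K L] [Algebra.IsAlgebraic K C] (c : ι → C)
    (hc : ∀ a, (K⟮c a⟯).LinearDisjoint (adjoin K (c '' {a' | a' ≠ a}))) :
    ∃ S : Finset ι, ∀ a ∉ S, (minpoly L (c a)).natDegree = (minpoly K (c a)).natDegree ∧
      (L⟮c a⟯).LinearDisjoint (adjoin L (c '' {a' | a' ≠ a})) := by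
  classical
  let U : IntermediateField K C := (IsScalarTower.toAlgHom K L C).fieldRange
  have hU : FiniteDimensional K U :=
    Module.Finite.equiv
      (AlgEquiv.ofInjectiveField (IsScalarTower.toAlgHom K L C)).toLinearEquiv
  have : Algebra.IsAlgebraic L C := Algebra.IsAlgebraic.tower_top (K := K) L
  obtain ⟨S, hS⟩ := exists_finset_finrank_sup_eq U c hc
  have hres (s : Set C) : (adjoin L s).restrictScalars K = U ⊔ adjoin K s := by
    let i : L ≃ₐ[K] U := AlgEquiv.ofInjectiveField (IsScalarTower.toAlgHom K L C)
    rw [restrictScalars_adjoin_of_algEquiv (L' := U) i (funext fun _ ↦ rfl) s]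
    exact restrictScalars_adjoin_eq_sup K U s
  have hintK (x : C) : IsIntegral K x := (Algebra.IsAlgebraic.isAlgebraic x).isIntegral
  have hintL (x : C) : IsIntegral L x := (Algebra.IsAlgebraic.isAlgebraic x).isIntegral
  have key (a : ι) (T : Finset ι) (hT : S ⊆ T) (ha : a ∉ T) :
      (minpoly (adjoin L (c '' (T : Set ι))) (c a)).natDegree = (minpoly K (c a)).natDegree := by
    have h1 := hS T hT a ha
    set B := adjoin L (c '' (T : Set ι)) with hB
    have hBC : IsIntegral B (c a) := (hintL (c a)).tower_top
    rw [← adjoin.finrank hBC, ← adjoin.finrank (hintK (c a))]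
    have : IsScalarTower K B C := IsScalarTower.of_algebraMap_eq fun _ ↦ rfl
    have e1 : Module.finrank K ↥(U ⊔ adjoin K (c '' (T : Set ι))) = Module.finrank K B := by
      rw [← hres]; rfl
    have e2 : Module.finrank K ↥(U ⊔ adjoin K (c '' (insert a (T : Set ι)))) =
        Module.finrank K (adjoin B {c a}) := by
      rw [← hres]
      have : adjoin L (c '' (insert a (T : Set ι))) = (adjoin B {c a}).restrictScalars L := by
        rw [adjoin_adjoin_left, Set.image_insert_eq, Set.insert_eq, Set.union_comm]
      rw [this]; rfl
    have hBfin : FiniteDimensional K B := by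
      have : FiniteDimensional L B := by
        have := (T.finite_toSet.image c).to_subtype
        exact finiteDimensional_adjoin fun x _ ↦ hintL x
      exact FiniteDimensional.trans K L B
    have hpos : 0 < Module.finrank K B := Module.finrank_pos
    rw [e1, e2, ← Module.finrank_mul_finrank K B] at h1
    exact Nat.eq_of_mul_eq_mul_left hpos h1
  have hle (a : ι) (B : IntermediateField L C) :
      (minpoly B (c a)).natDegree ≤ (minpoly L (c a)).natDegree := by
    have := Polynomial.natDegree_le_of_dvd (minpoly.dvd_map_of_isScalarTower L B (c a))
      (Polynomial.map_ne_zero (minpoly.ne_zero (hintL _)))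
    simpa using this
  have hle' (a : ι) : (minpoly L (c a)).natDegree ≤ (minpoly K (c a)).natDegree := by
    have := Polynomial.natDegree_le_of_dvd (minpoly.dvd_map_of_isScalarTower K L (c a))
      (Polynomial.map_ne_zero (minpoly.ne_zero (hintK _)))
    simpa using this
  refine ⟨S, fun a ha ↦ ?_⟩
  have hLK : (minpoly L (c a)).natDegree = (minpoly K (c a)).natDegree :=
    le_antisymm (hle' a) ((key a S subset_rfl ha).symm.trans_le (hle a _))
  refine ⟨hLK, ?_⟩
  set V := adjoin L (c '' {a' | a' ≠ a}) with hV
  have hdeg : (minpoly L (c a)).natDegree ≤ (minpoly V (c a)).natDegree := by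
    set q := minpoly V (c a) with hq
    have hfs (i : ℕ) : ∃ T : Finset ι, a ∉ T ∧ (q.coeff i : C) ∈ adjoin L (c '' (T : Set ι)) := by
      obtain ⟨T, hT, hmem⟩ := exists_finset_of_mem_adjoin (q.coeff i).2
      obtain ⟨T', hT', rfl⟩ := Finset.subset_set_image_iff.mp hT
      exact ⟨T', fun h ↦ hT' h rfl, by simpa using hmem⟩
    choose T haT hT using hfs
    let T0 := S ∪ (Finset.range (q.natDegree + 1)).biUnion T
    have haT0 : a ∉ T0 := by simp [T0, ha, haT]
    have hmem (i : ℕ) : (q.coeff i : C) ∈ adjoin L (c '' (T0 : Set ι)) := by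
      by_cases hi : i ≤ q.natDegree
      · refine adjoin.mono _ _ _ (Set.image_mono ?_) (hT i)
        intro x hx
        simp only [T0, Finset.coe_union, Finset.coe_biUnion]
        exact Or.inr (Set.mem_biUnion (by simpa [Nat.lt_succ_iff] using hi) hx)
      · rw [Polynomial.coeff_eq_zero_of_natDegree_lt (by omega)]; exact zero_mem _
    have hlift : q.map (algebraMap V C) ∈ Polynomial.lifts
        (algebraMap (adjoin L (c '' (T0 : Set ι))) C) := by
      rw [Polynomial.lifts_iff_coeff_lifts]
      intro i
      exact ⟨⟨_, hmem i⟩, by rw [Polynomial.coeff_map]; rfl⟩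
    have hqm : q.Monic := minpoly.monic (hintL (c a)).tower_top
    obtain ⟨q', hq', hdq', hm'⟩ := Polynomial.lifts_and_natDegree_eq_and_monic hlift (hqm.map _)
    have hroot : Polynomial.aeval (c a) q' = 0 := by
      rw [← Polynomial.aeval_map_algebraMap C, hq', Polynomial.aeval_map_algebraMap, hq]
      exact minpoly.aeval _ _
    have := Polynomial.natDegree_le_of_dvd (minpoly.dvd _ _ hroot) hm'.ne_zero
    rw [key a T0 Finset.subset_union_left haT0, hdq', Polynomial.natDegree_map] at this
    exact hLK.trans_le this
  have heq : (minpoly L (c a)).natDegree = (minpoly V (c a)).natDegree :=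
    le_antisymm hdeg (hle a V)
  refine LinearDisjoint.of_basis_left (adjoin.powerBasis (hintL (c a))).basis ?_
  have hli := linearIndependent_pow (K := V) (c a)
  have hd : (adjoin.powerBasis (hintL (c a))).dim = (minpoly V (c a)).natDegree := by
    rw [← heq]; rfl
  convert hli.comp (finCongr hd) (finCongr hd).injective using 1
  ext i
  simp

open IntermediateField in
theorem natDegree_minpoly_eq_mul_of_mem_adjoin {F E : Type*} [Field F] [Field E] [Algebra F E]
    {y z : E} (hz : IsIntegral F z) (hy : y ∈ F⟮z⟯) :
    (minpoly F z).natDegree = (minpoly F y).natDegree * (minpoly F⟮y⟯ z).natDegree := by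
  have := adjoin.finiteDimensional hz
  have hyi : IsIntegral F y := by
    have : IsIntegral F (⟨y, hy⟩ : F⟮z⟯) := IsIntegral.of_finite _ _
    exact this.map F⟮z⟯.val
  have e : F⟮z⟯ = (adjoin F⟮y⟯ {z}).restrictScalars F := by
    rw [adjoin_adjoin_left]
    apply le_antisymm
    · exact adjoin.mono _ _ _ Set.subset_union_right
    · rw [adjoin_le_iff]
      rintro x (rfl | rfl)
      · exact hy
      · exact mem_adjoin_simple_self F x
  rw [← adjoin.finrank hz, ← adjoin.finrank hyi, ← adjoin.finrank (K := F⟮y⟯) hz.tower_top,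
    Module.finrank_mul_finrank, e]
  rfl

/-- A pair of ring homomorphisms with `ker π ≤ ker ev` behaves like a place: relations between
fractions over `π` specialize to relations between fractions over `ev`. -/
theorem exists_localization_of_ker_le {S Ω C : Type*} [CommRing S] [Field Ω] [Field C]
    (π : S →+* Ω) (ev : S →+* C) (h : ∀ p, π p = 0 → ev p = 0) (s : S) (hs : ev s ≠ 0) :
    ∃ (π' : Localization.Away s →+* Ω) (ev' : Localization.Away s →+* C),
      π'.comp (algebraMap S _) = π ∧ ev'.comp (algebraMap S _) = ev ∧
      ∀ p, π' p = 0 → ev' p = 0 := by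
  have hπ : IsUnit (π s) := isUnit_iff_ne_zero.mpr fun h0 ↦ hs (h _ h0)
  have he : IsUnit (ev s) := isUnit_iff_ne_zero.mpr hs
  refine ⟨IsLocalization.Away.lift s hπ, IsLocalization.Away.lift s he,
    IsLocalization.Away.lift_comp s hπ, IsLocalization.Away.lift_comp s he, fun p hp ↦ ?_⟩
  obtain ⟨n, a, ha⟩ := IsLocalization.Away.surj s p
  have h1 := congrArg (IsLocalization.Away.lift s hπ) ha
  have h2 := congrArg (IsLocalization.Away.lift s he) ha
  rw [map_mul, hp, zero_mul, IsLocalization.Away.lift_eq] at h1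
  rw [map_mul, map_pow, IsLocalization.Away.lift_eq, IsLocalization.Away.lift_eq,
    h a h1.symm] at h2
  exact (mul_eq_zero.mp h2).resolve_right (pow_ne_zero _ hs)

open IntermediateField in
theorem exists_aeval_eq_mul_of_mem_adjoin {R F Ω : Type*} [CommRing R] [IsDomain R] [Field F]
    [Field Ω] [Algebra R F] [IsFractionRing R F] [Algebra F Ω] [Algebra R Ω] [IsScalarTower R F Ω]
    {z w : Ω} (hz : IsIntegral F z) (hw : w ∈ F⟮z⟯) :
    ∃ r : R, r ≠ 0 ∧ ∃ q : R[X], aeval z q = algebraMap R Ω r * w := by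
  obtain ⟨q0, rfl⟩ : ∃ q0 : F[X], aeval z q0 = w := by
    rw [← mem_toSubalgebra, adjoin_simple_toSubalgebra_of_isAlgebraic hz.isAlgebraic,
      Algebra.adjoin_singleton_eq_range_aeval] at hw
    exact hw
  obtain ⟨r, hr, h⟩ := IsLocalization.integerNormalization_spec (nonZeroDivisors R) q0
  refine ⟨r, nonZeroDivisors.ne_zero hr,
    IsLocalization.integerNormalization (nonZeroDivisors R) q0, ?_⟩
  rw [← aeval_map_algebraMap F z (IsLocalization.integerNormalization _ _), h,
    ← algebraMap_smul F r q0, map_smul, Algebra.smul_def,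
    ← IsScalarTower.algebraMap_apply]

open IntermediateField in
theorem exists_aeval_eq_mul_of_forall_mem_adjoin {R F Ω ι : Type*} [CommRing R] [IsDomain R]
    [Field F] [Field Ω] [Algebra R F] [IsFractionRing R F] [Algebra F Ω] [Algebra R Ω]
    [IsScalarTower R F Ω] [Fintype ι]
    {z : Ω} {w : ι → Ω} (hz : IsIntegral F z) (hw : ∀ i, w i ∈ F⟮z⟯) :
    ∃ r : R, r ≠ 0 ∧ ∃ q : ι → R[X], ∀ i, aeval z (q i) = algebraMap R Ω r * w i := by
  classical
  choose r hr q hq using fun i ↦ exists_aeval_eq_mul_of_mem_adjoin (R := R) hz (hw i)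
  refine ⟨∏ i, r i, Finset.prod_ne_zero_iff.mpr fun i _ ↦ hr i,
    fun i ↦ (∏ j ∈ Finset.univ.erase i, r j) • q i, fun i ↦ ?_⟩
  rw [map_smul, hq, Algebra.smul_def, ← mul_assoc, ← map_mul,
    Finset.prod_erase_mul _ _ (Finset.mem_univ i)]

open IntermediateField in
theorem exists_specialization {L F Ω E : Type*} [Field L] [Field F] [Field Ω] [Field E]
    [Algebra L[X] F] [IsFractionRing L[X] F] [Algebra F Ω] [Algebra L[X] Ω]
    [IsScalarTower L[X] F Ω] [Algebra L E] {z y : Ω} (hz : IsIntegral L[X] z)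
    (hy : y ∈ F⟮z⟯) (f : L[X][X]) (hf : aeval y f = 0) :
    ∃ r : L[X], r ≠ 0 ∧ ∀ (a : L) (c : E), r.eval a ≠ 0 →
      eval₂ ((algebraMap L E).comp (evalRingHom a)) c (minpoly L[X] z) = 0 →
      (minpoly L c).natDegree = (minpoly L[X] z).natDegree →
      ∃ b ∈ L⟮c⟯, eval₂ ((algebraMap L E).comp (evalRingHom a)) b f = 0 ∧
        (minpoly F y).natDegree ≤ (minpoly L b).natDegree := by
  have hzF : IsIntegral F z := hz.tower_top
  have hyF : IsIntegral F y := by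
    have := adjoin.finiteDimensional hzF
    have : IsIntegral F (⟨y, hy⟩ : F⟮z⟯) := IsIntegral.of_finite _ _
    exact this.map F⟮z⟯.val
  have hinj : Function.Injective (algebraMap L[X] Ω) := by
    rw [IsScalarTower.algebraMap_eq L[X] F Ω]
    exact (algebraMap F Ω).injective.comp (IsFractionRing.injective L[X] F)
  have : FaithfulSMul L[X] Ω := (faithfulSMul_iff_algebraMap_injective _ _).mpr hinj
  have : Module.IsTorsionFree L[X] Ω := inferInstance
  obtain ⟨r1, hr1, q, hqy⟩ := exists_aeval_eq_mul_of_mem_adjoin (R := L[X]) hzF hy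
  have hzy : IsIntegral F⟮y⟯ z := hzF.tower_top
  set H := minpoly F⟮y⟯ z with hH
  set l := H.natDegree with hl
  obtain ⟨r2, hr2, G, hG⟩ := exists_aeval_eq_mul_of_forall_mem_adjoin (R := L[X]) hyF
    (w := fun i : Fin l ↦ (H.coeff i : Ω)) (fun i ↦ (H.coeff i).2)
  refine ⟨r1 * r2, mul_ne_zero hr1 hr2, fun a c ha hc hdeg ↦ ?_⟩
  rw [eval_mul, mul_ne_zero_iff] at ha
  set θ : L[X] →+* E := (algebraMap L E).comp (evalRingHom a) with hθ
  obtain ⟨π', ev', hπ', hev', hker⟩ := exists_localization_of_ker_le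
    (aeval z : L[X][X] →ₐ[L[X]] Ω).toRingHom (eval₂RingHom θ c) (fun p hp ↦ by
      obtain ⟨g, rfl⟩ := minpoly.isIntegrallyClosed_dvd hz hp
      simp [eval₂_mul, hc]) (C r1) (by simpa [hθ] using ha.1)
  let S' := Localization.Away (C r1 : L[X][X])
  let y' : S' := IsLocalization.mk' S' q (⟨C r1, 1, pow_one _⟩ : Submonoid.powers (C r1))
  have hpiR (p : L[X][X]) : π' (algebraMap _ S' p) = aeval z p := DFunLike.congr_fun hπ' p
  have hevR (p : L[X][X]) : ev' (algebraMap _ S' p) = eval₂ θ c p := DFunLike.congr_fun hev' p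
  have hy' : π' y' = y := by
    have h1 := congrArg π' (IsLocalization.mk'_spec S' q
      (⟨C r1, 1, pow_one _⟩ : Submonoid.powers (C r1)))
    rw [map_mul, hpiR, hpiR, hqy, aeval_C, mul_comm] at h1
    exact mul_left_cancel₀ ((map_ne_zero_iff _ hinj).mpr hr1) h1
  let inc : L[X] →+* S' := (algebraMap L[X][X] S').comp C
  have hinc1 : π'.comp inc = algebraMap L[X] Ω := by
    ext s <;> simp [inc, hpiR]
  have hinc2 : ev'.comp inc = θ := by
    ext s <;> simp [inc, hevR]
  have hc1 : ev' (algebraMap L[X][X] S' X) = c := by simp [hevR]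
  have hz1 : π' (algebraMap L[X][X] S' X) = z := by simp [hpiR]
  have hb : ev' y' ∈ L⟮c⟯ := by
    have h1 := congrArg ev' (IsLocalization.mk'_spec S' q
      (⟨C r1, 1, pow_one _⟩ : Submonoid.powers (C r1)))
    rw [map_mul, hevR, hevR, eval₂_C] at h1
    have h2 : ev' y' = eval₂ θ c q * (θ r1)⁻¹ :=
      (eq_mul_inv_iff_mul_eq₀ (by simpa [hθ] using ha.1)).mpr h1
    rw [h2, hθ, ← eval₂_map]
    refine mul_mem ?_ (inv_mem (IntermediateField.algebraMap_mem _ _))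
    exact algebra_adjoin_le_adjoin _ _ (aeval_mem_adjoin_singleton _ _)
  refine ⟨ev' y', hb, ?_, ?_⟩
  · rw [← hinc2, ← hom_eval₂]
    apply hker
    rw [hom_eval₂, hy', hinc1]
    exact hf
  · have hN : (minpoly L[X] z).natDegree = (minpoly F z).natDegree := by
      rw [minpoly.isIntegrallyClosed_eq_field_fractions' F hz,
        (minpoly.monic hz).natDegree_map]
    have hcint : IsIntegral L c := by
      by_contra h
      rw [minpoly.eq_zero h, natDegree_zero] at hdeg
      exact (minpoly.natDegree_pos hz).ne hdeg
    have hlpos : 0 < l := minpoly.natDegree_pos hzy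
    have hrel : θ r2 * c ^ l + ∑ i : Fin l, eval₂ θ (ev' y') (G i) * c ^ (i : ℕ) = 0 := by
      have h0 := hker (inc r2 * (algebraMap L[X][X] S' X) ^ l +
        ∑ i : Fin l, eval₂ inc y' (G i) * (algebraMap L[X][X] S' X) ^ (i : ℕ)) (by
        have hinc1' (s) : π' (inc s) = algebraMap L[X] Ω s := DFunLike.congr_fun hinc1 s
        have h2 : aeval z H = 0 := minpoly.aeval _ _
        simp only [map_add, map_mul, map_sum, map_pow, hz1, hom_eval₂, hinc1, hy', hinc1']
        simp only [← aeval_def, hG]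
        rw [aeval_eq_sum_range, Finset.sum_range_succ, Finset.sum_range] at h2
        rw [← mul_zero (algebraMap L[X] Ω r2), ← h2, mul_add, Finset.mul_sum, add_comm]
        congr 1
        · refine Finset.sum_congr rfl fun i _ ↦ ?_
          rw [Algebra.smul_def, mul_assoc]; rfl
        · rw [← hl, (minpoly.monic hzy : H.Monic).coeff_natDegree, one_smul])
      have hinc2' (s) : ev' (inc s) = θ s := DFunLike.congr_fun hinc2 s
      simpa only [map_add, map_mul, map_sum, map_pow, hc1, hom_eval₂, hinc2, hinc2'] using h0
    have hmem (p : L[X][X]) : eval₂ θ (ev' y') p ∈ L⟮ev' y'⟯ := by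
      rw [hθ, ← eval₂_map]
      exact algebra_adjoin_le_adjoin _ _ (aeval_mem_adjoin_singleton _ _)
    let P : L⟮ev' y'⟯[X] := C (algebraMap L _ (r2.eval a)) * X ^ l +
      ∑ i : Fin l, C ⟨_, hmem (G i)⟩ * X ^ (i : ℕ)
    have hP0 : P ≠ 0 := by
      intro h0
      have h1 := congrArg (fun p ↦ coeff p l) h0
      simp only [P, coeff_add, finsetSum_coeff, coeff_C_mul, coeff_X_pow, coeff_zero] at h1
      rw [Finset.sum_eq_zero fun i _ ↦ by rw [if_neg i.2.ne', mul_zero]] at h1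
      simp [ha.2] at h1
    have hPl : P.natDegree ≤ l := by
      refine natDegree_add_le_of_degree_le (natDegree_C_mul_X_pow_le _ _) ?_
      refine natDegree_sum_le_of_forall_le _ _ fun i _ ↦ ?_
      exact (natDegree_C_mul_X_pow_le _ _).trans i.2.le
    have hPc : aeval c P = 0 := by
      simp only [P, map_add, map_mul, map_sum, map_pow, aeval_C, aeval_X]
      exact hrel
    have h1 := natDegree_minpoly_eq_mul_of_mem_adjoin hzF hy
    have h2 := natDegree_minpoly_eq_mul_of_mem_adjoin hcint hb
    have h3 : (minpoly L⟮ev' y'⟯ c).natDegree ≤ l :=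
      (natDegree_le_of_dvd (minpoly.dvd _ _ hPc) hP0).trans hPl
    rw [← hN, ← hdeg, h2, ← hH, ← hl] at h1
    exact Nat.le_of_mul_le_mul_right (h1 ▸ Nat.mul_le_mul_left _ h3) hlpos

open PowerSeries in
theorem PowerSeries.eq_zero_of_sum_mul_rescale_X_eq_zero {k I κ : Type*} [Field k] [Fintype κ]
    (i : I) (e : κ → k⟦X⟧)
    (he : ∀ q : κ → k[X], ∑ m, (q m : k⟦X⟧) * e m = 0 → ∀ m, q m = 0)
    (u : κ → (MvPolynomial I k)⟦X⟧)
    (hu : ∀ m, ∃ B : ℕ, ∀ l, (coeff l (u m)).degreeOf i ≤ B)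
    (h : ∑ m, u m * rescale (MvPolynomial.X i) (map MvPolynomial.C (e m)) = 0) (m : κ) :
    u m = 0 := by
  classical
  choose B' hB' using hu
  set B := Finset.univ.sup B'
  have hB (m l) : (coeff l (u m)).degreeOf i ≤ B :=
    (hB' m l).trans (Finset.le_sup (f := B') (Finset.mem_univ m))
  ext l s
  set s' := s.erase i
  set D := l + B - s i with hD
  by_contra hne
  have hsB : s i ≤ B := by
    by_contra hlt
    exact hne (MvPolynomial.notMem_support_iff.mp fun hmem ↦
      hlt ((MvPolynomial.monomial_le_degreeOf i hmem).trans (hB m l)))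
  let c (m : κ) (j : ℕ) : k := if B ≤ D + j then
    MvPolynomial.coeff (s' + Finsupp.single i j) (coeff (D + j - B) (u m)) else 0
  have hc (m : κ) (j : ℕ) (hj : B < j) : c m j = 0 := by
    simp only [c]
    split_ifs
    · refine MvPolynomial.notMem_support_iff.mp fun hmem ↦ ?_
      have := (MvPolynomial.monomial_le_degreeOf i hmem).trans (hB m _)
      simp [s'] at this
      omega
    · rfl
  let q (m : κ) : k[X] := ∑ j ∈ Finset.range (B + 1), Polynomial.monomial j (c m j)
  have hq (m : κ) (j : ℕ) : (q m).coeff j = c m j := by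
    simp only [q, Polynomial.finsetSum_coeff, Polynomial.coeff_monomial]
    rw [Finset.sum_ite_eq']
    split_ifs with hj
    · rfl
    · rw [hc]; simpa using hj
  have hq0 := he q (by
    ext β
    have h1 := congrArg (fun Φ ↦ MvPolynomial.coeff (s' + Finsupp.single i β)
      (coeff (D + β) (PowerSeries.X ^ B * Φ))) h
    simp only [Finset.mul_sum, map_sum, mul_zero, map_zero, MvPolynomial.coeff_sum,
      MvPolynomial.coeff_zero] at h1
    rw [map_sum, map_zero, ← h1]
    refine Finset.sum_congr rfl fun m _ ↦ ?_
    rw [← mul_assoc, PowerSeries.coeff_mul, PowerSeries.coeff_mul, MvPolynomial.coeff_sum]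
    refine Finset.sum_of_injOn (fun p ↦ (D + p.1, p.2)) ?_ ?_ ?_ ?_
    · rintro ⟨a, b⟩ - ⟨c, d⟩ - h
      simp only [Prod.mk.injEq] at h ⊢
      omega
    · rintro ⟨a, b⟩ h
      rw [Finset.mem_coe, Finset.HasAntidiagonal.mem_antidiagonal] at h ⊢
      dsimp only at h ⊢; omega
    · rintro ⟨a, b⟩ h1 h2
      rw [Finset.HasAntidiagonal.mem_antidiagonal] at h1
      have hb : β < b := by
        by_contra hb
        exact h2 ⟨(a - D, b), by simp; omega, by simp; omega⟩
      rw [coeff_rescale, coeff_map, mul_comm (MvPolynomial.X i ^ b), ← mul_assoc,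
        MvPolynomial.X_pow_eq_monomial, MvPolynomial.coeff_mul_monomial', if_neg]
      intro hle
      have := hle i
      simp [s'] at this
      omega
    · rintro ⟨a, b⟩ h1
      rw [Finset.HasAntidiagonal.mem_antidiagonal] at h1
      rw [coeff_rescale, coeff_map, mul_comm (MvPolynomial.X i ^ b), ← mul_assoc,
        MvPolynomial.X_pow_eq_monomial, MvPolynomial.coeff_mul_monomial', if_pos, mul_one,
        mul_comm _ (MvPolynomial.C _), MvPolynomial.coeff_C_mul, mul_comm (coeff b (e m)),
        coeff_X_pow_mul', Polynomial.coeff_coe, hq,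
        show s' + Finsupp.single i β - Finsupp.single i b = s' + Finsupp.single i a by
          rw [← h1, Finsupp.single_add, ← add_assoc, add_tsub_cancel_right]]
      · congr 1
        simp only [c]
        split_ifs <;> simp
      · rw [← h1, Finsupp.single_add, ← add_assoc]
        exact le_add_self) m
  apply hne
  have h2 := hq m (s i)
  rw [hq0, Polynomial.coeff_zero] at h2
  simp only [c] at h2
  rw [if_pos (by omega), show D + s i - B = l by omega, Finsupp.erase_add_single] at h2
  exact h2.symm

open scoped PowerSeries

/-- Power series over a multivariate polynomial ring whose coefficients have bounded degree in the
variable `i`. -/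
def boundedDegreeOfSubalgebra {k I : Type*} [CommRing k] (i : I) :
    Subalgebra (MvPolynomial I k)[X] (MvPolynomial I k)⟦X⟧ where
  carrier := {Φ | ∃ B : ℕ, ∀ l, (PowerSeries.coeff l Φ).degreeOf i ≤ B}
  mul_mem' := by
    rintro a b ⟨A, hA⟩ ⟨B, hB⟩
    refine ⟨A + B, fun l ↦ ?_⟩
    rw [PowerSeries.coeff_mul]
    refine (MvPolynomial.degreeOf_sum_le _ _ _).trans (Finset.sup_le fun p _ ↦ ?_)
    exact (MvPolynomial.degreeOf_mul_le _ _ _).trans (add_le_add (hA _) (hB _))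
  add_mem' := by
    rintro a b ⟨A, hA⟩ ⟨B, hB⟩
    refine ⟨max A B, fun l ↦ ?_⟩
    rw [map_add]
    exact (MvPolynomial.degreeOf_add_le _ _ _).trans (max_le_max (hA _) (hB _))
  algebraMap_mem' p := by
    refine ⟨p.support.sup fun l ↦ (p.coeff l).degreeOf i, fun l ↦ ?_⟩
    change MvPolynomial.degreeOf i (PowerSeries.coeff l (p : (MvPolynomial I k)⟦X⟧)) ≤ _
    rw [Polynomial.coeff_coe]
    by_cases h : l ∈ p.support
    · exact Finset.le_sup (f := fun l ↦ (p.coeff l).degreeOf i) h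
    · rw [notMem_support_iff.mp h, MvPolynomial.degreeOf_zero]
      exact zero_le

/-- The substitution `X ↦ θᵢ X`, from power series over `k` to power series over `k[θ]`. -/
noncomputable def genericRescale {k I : Type*} [CommRing k] (i : I) :
    k⟦X⟧ →+* (MvPolynomial I k)⟦X⟧ :=
  (PowerSeries.rescale (MvPolynomial.X i)).comp (PowerSeries.map MvPolynomial.C)

theorem coeff_genericRescale {k I : Type*} [CommRing k] (i : I) (η : k⟦X⟧) (l : ℕ) :
    PowerSeries.coeff l (genericRescale i η) =
      MvPolynomial.X i ^ l * MvPolynomial.C (PowerSeries.coeff l η) := by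
  simp [genericRescale, PowerSeries.coeff_rescale]

theorem genericRescale_mem_boundedDegreeOfSubalgebra {k I : Type*} [Field k] {i j : I}
    (hij : i ≠ j) (η : k⟦X⟧) : genericRescale j η ∈ boundedDegreeOfSubalgebra (k := k) i := by
  refine ⟨0, fun l ↦ ?_⟩
  rw [coeff_genericRescale]
  refine (MvPolynomial.degreeOf_mul_le _ _ _).trans ?_
  rw [MvPolynomial.degreeOf_C, add_zero]
  refine (MvPolynomial.degreeOf_pow_le _ _ _).trans ?_
  rw [MvPolynomial.degreeOf_X_of_ne hij, mul_zero]

theorem genericRescale_injective {k I : Type*} [Field k] (i : I) :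
    Function.Injective (genericRescale (k := k) i) := by
  rw [injective_iff_map_eq_zero]
  intro η h
  ext l
  have := congrArg (PowerSeries.coeff l) h
  rw [coeff_genericRescale, map_zero] at this
  simpa [MvPolynomial.X_ne_zero] using this

theorem exists_linearIndependent_genericRescale {k I : Type*} [Field k] (n : ℕ) (η : I → k⟦X⟧)
    (hη : ∀ i, LinearIndependent k[X] fun m : Fin n ↦ η i ^ (m : ℕ)) (J : Finset I) :
    ∃ (ι : Type) (_ : Fintype ι) (v : ι → (MvPolynomial I k)⟦X⟧), Fintype.card ι = n ^ J.card ∧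
      LinearIndependent (MvPolynomial I k)[X] v ∧
      ∀ s, v s ∈ Algebra.adjoin (MvPolynomial I k)[X] ((fun i ↦ genericRescale i (η i)) '' J) := by
  classical
  induction J using Finset.induction_on with
  | empty =>
    refine ⟨Unit, inferInstance, fun _ ↦ 1, by simp, ?_, fun _ ↦ one_mem _⟩
    rw [Fintype.linearIndependent_iff]
    intro g hg s
    simp only [Finset.univ_unique, Finset.sum_singleton, Algebra.smul_def, mul_one] at hg
    exact Polynomial.coe_injective _ (hg.trans Polynomial.coe_zero.symm)
  | insert i J hi ih =>
    obtain ⟨ι, _, v, hcard, hv, hmem⟩ := ih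
    refine ⟨ι × Fin n, inferInstance, fun s ↦ v s.1 * genericRescale i (η i) ^ (s.2 : ℕ), ?_, ?_,
      fun s ↦ ?_⟩
    · rw [Fintype.card_prod, hcard, Fintype.card_fin, Finset.card_insert_of_notMem hi, pow_succ]
    · rw [Fintype.linearIndependent_iff] at hv ⊢
      rintro g hg ⟨s, m⟩
      refine hv (fun s ↦ g (s, m)) ?_ s
      refine PowerSeries.eq_zero_of_sum_mul_rescale_X_eq_zero (κ := Fin n) i
        (fun m ↦ η i ^ (m : ℕ)) (fun q hq ↦ ?_) (fun m ↦ ∑ s, g (s, m) • v s) (fun m ↦ ?_) ?_ m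
      · exact Fintype.linearIndependent_iff.mp (hη i) q (by simp only [Algebra.smul_def]; exact hq)
      · refine sum_mem (S := boundedDegreeOfSubalgebra (k := k) i) fun s _ ↦
          Subalgebra.smul_mem _ (?_ : _ ∈ boundedDegreeOfSubalgebra i) _
        refine Algebra.adjoin_le ?_ (hmem s)
        rintro _ ⟨j, hj, rfl⟩
        refine genericRescale_mem_boundedDegreeOfSubalgebra ?_ _
        rintro rfl
        exact hi hj
      · rw [Fintype.sum_prod_type_right] at hg
        rw [← hg]
        refine Finset.sum_congr rfl fun m _ ↦ ?_
        rw [Finset.sum_mul]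
        refine Finset.sum_congr rfl fun s _ ↦ ?_
        rw [smul_mul_assoc, ← map_pow]
        rfl
    · refine mul_mem (Algebra.adjoin_mono (Set.image_mono ?_) (hmem s.1))
        (pow_mem (Algebra.subset_adjoin (Set.mem_image_of_mem _ ?_)) _)
      · simp
      simp

open IntermediateField in
theorem exists_adjoin_sum_eq_top {K L k M E I : Type*} [Field K] [Infinite K] [Field L] [Field k]
    [Field M] [Field E] [Algebra K L] [Algebra K k] [Algebra k M] [Algebra M E]
    [FiniteDimensional M E] [Algebra.IsSeparable M E] [Fintype I] (σ : I → L →ₐ[K] k)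
    (hσ : Function.Injective σ) (Y : I → E) 
    (hY : ∀ φ ψ : E →ₐ[M] AlgebraicClosure M, (∀ i, φ (Y i) = ψ (Y i)) → φ = ψ) :
    ∃ w : L, M⟮∑ i, algebraMap M E (algebraMap k M (σ i w)) * Y i⟯ = ⊤ := by
  classical
  let A := AlgebraicClosure M
  let d (P : (E →ₐ[M] A) × (E →ₐ[M] A)) (i : I) : A := P.1 (Y i) - P.2 (Y i)
  let W (P : (E →ₐ[M] A) × (E →ₐ[M] A)) : Subspace K L :=
    { carrier := {w | ∑ i, algebraMap M A (algebraMap k M (σ i w)) * d P i = 0}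
      add_mem' := fun {a b} ha hb ↦ by
        simp only [Set.mem_ofPred_eq, map_add, add_mul, Finset.sum_add_distrib] at *
        rw [ha, hb, add_zero]
      zero_mem' := by simp
      smul_mem' := fun c x hx ↦ by
        simp only [Set.mem_ofPred_eq, map_smul] at *
        simp only [Algebra.smul_def, map_mul, mul_assoc]
        rw [← Finset.mul_sum, hx, mul_zero] }
  have hW (P) (hP : P.1 ≠ P.2) : W P ≠ ⊤ := by
    intro htop
    apply hP
    have hli : LinearIndependent A fun i ↦ ((((algebraMap M A).comp (algebraMap k M)).comp
        (σ i : L →+* k) : L →* A) : L → A) := by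
      refine (linearIndependent_monoidHom L A).comp (fun i ↦
        (((algebraMap M A).comp (algebraMap k M)).comp (σ i : L →+* k) : L →* A)) fun i j h ↦ hσ ?_
      ext x
      exact ((algebraMap M A).comp (algebraMap k M)).injective (DFunLike.congr_fun h x)
    have h0 := Fintype.linearIndependent_iff.mp hli (d P) (by
      ext w
      have : w ∈ W P := htop ▸ Submodule.mem_top
      change ∑ i, _ = 0 at this
      simpa [mul_comm] using this)
    exact hY _ _ fun i ↦ sub_eq_zero.mp (h0 i)
  let s : Finset (Subspace K L) := (Finset.univ.filter fun P ↦ P.1 ≠ P.2).image W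
  have hs : ⊤ ∉ s := by
    simp only [s, Finset.mem_image, Finset.mem_filter, Finset.mem_univ, true_and, not_exists,
      not_and]
    exact hW
  obtain ⟨w, hw⟩ := (Set.ne_univ_iff_exists_notMem _).mp (Subspace.biUnion_ne_univ_of_top_notMem hs)
  refine ⟨w, ?_⟩
  rw [Field.primitive_element_iff_algHom_eq_of_eval' M A fun x ↦ IsAlgClosed.splits _]
  intro φ ψ h
  by_contra hne
  apply hw
  simp only [Set.mem_iUnion]
  refine ⟨W (φ, ψ), Finset.mem_image_of_mem _ (by simpa using hne), ?_⟩
  change ∑ i, _ = 0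
  simp only [map_sum, map_mul, AlgHom.commutes] at h
  simp only [d, mul_sub, Finset.sum_sub_distrib, sub_eq_zero]
  exact h

theorem exists_linearIndependent_powerSeries_map {R k ι : Type*} [CommRing R] [IsDomain R]
    [Field k] [Fintype ι] {v : ι → R⟦X⟧} (hv : LinearIndependent R v) :
    ∃ P : R, P ≠ 0 ∧ ∀ e : R →+* k, e P ≠ 0 →
      LinearIndependent k fun s ↦ PowerSeries.map e (v s) := by
  classical
  let Q := FractionRing R
  let col (l : ℕ) : ι → Q := fun s ↦ algebraMap R Q (PowerSeries.coeff l (v s))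
  have hspan : Submodule.span Q (Set.range col) = ⊤ := by
    by_contra hne
    obtain ⟨f, hf, hle⟩ := Submodule.exists_le_ker_of_lt_top _ (lt_top_iff_ne_top.mpr hne)
    have hv' : LinearIndependent R fun s l ↦ algebraMap R Q (PowerSeries.coeff l (v s)) := by
      rw [Fintype.linearIndependent_iff] at hv ⊢
      intro g hg
      refine hv g ?_
      ext l
      have := congrFun hg l
      simp only [Finset.sum_apply, Pi.smul_apply, Pi.zero_apply] at this
      simp only [Algebra.smul_def, ← map_mul, ← map_sum] at this
      rw [FaithfulSMul.algebraMap_eq_zero_iff] at this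
      simpa using this
    rw [LinearIndependent.iff_fractionRing R Q, Fintype.linearIndependent_iff] at hv'
    apply hf
    have h0 := hv' (fun s ↦ f (Pi.single s 1)) (by
      ext l
      have : f (col l) = 0 := hle (Submodule.subset_span ⟨l, rfl⟩)
      rw [LinearMap.pi_apply_eq_sum_univ] at this
      have hs (s : ι) : (fun j ↦ if s = j then (1 : Q) else 0) = Pi.single s 1 := by
        ext j
        simp [Pi.single_apply, eq_comm]
      simpa [col, mul_comm, hs] using this)
    ext s
    simpa using h0 s
  obtain ⟨f, hf, hf', hli⟩ := Submodule.exists_fun_fin_finrank_span_eq Q (Set.range col)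
  have hcard : Module.finrank Q (Submodule.span Q (Set.range col)) = Fintype.card ι := by
    rw [hspan, finrank_top, Module.finrank_fintype_fun_eq_card]
  choose l hl using hf
  let eqv : ι ≃ Fin (Module.finrank Q (Submodule.span Q (Set.range col))) :=
    (Fintype.equivFin ι).trans (finCongr hcard.symm)
  let B : Matrix ι ι R := fun j s ↦ PowerSeries.coeff (l (eqv j)) (v s)
  have hB : LinearIndependent Q (B.map (algebraMap R Q)).row := by
    have h1 : (B.map (algebraMap R Q)).row = f ∘ eqv := by
      ext j s
      exact congrFun (hl (eqv j)) s
    rw [h1]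
    exact hli.comp eqv eqv.injective
  refine ⟨B.det, ?_, fun e he ↦ ?_⟩
  · intro h0
    rw [Matrix.linearIndependent_rows_iff_isUnit, Matrix.isUnit_iff_isUnit_det,
      ← RingHom.mapMatrix_apply, ← RingHom.map_det, h0, map_zero] at hB
    exact not_isUnit_zero hB
  · have h1 : LinearIndependent k (B.map e).col := by
      rw [Matrix.linearIndependent_cols_iff_isUnit, Matrix.isUnit_iff_isUnit_det,
        ← RingHom.mapMatrix_apply, ← RingHom.map_det]
      exact he.isUnit
    rw [Fintype.linearIndependent_iff] at h1 ⊢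
    intro g hg
    refine h1 g ?_
    ext j
    have := congrArg (PowerSeries.coeff (l (eqv j))) hg
    simp only [map_sum, map_smul, PowerSeries.coeff_map, map_zero] at this
    simp only [Finset.sum_apply, Pi.smul_apply]
    exact this

theorem exists_eval_algHom_ne_zero {K L k I : Type*} [Field K] [Infinite K] [Field L] [Field k]
    [Algebra K L] [Algebra K k] [FiniteDimensional K L] [Fintype I] [Nonempty I]
    (σ : I → L →ₐ[K] k) (hσ : Function.Injective σ) {P : MvPolynomial I k} (hP : P ≠ 0) :
    ∃ t : L, t ≠ 0 ∧ MvPolynomial.eval (fun i ↦ σ i t) P ≠ 0 := by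
  classical
  let b := Module.finBasis K L
  let A : Matrix I (Fin (Module.finrank K L)) k := fun i j ↦ σ i (b j)
  have hA : LinearIndependent k A.row := by
    have hli : LinearIndependent k fun i ↦ (((σ i : L →+* k) : L →* k) : L → k) :=
      (linearIndependent_monoidHom L k).comp (fun i ↦ ((σ i : L →+* k) : L →* k)) fun i j h ↦
        hσ <| by
        ext x
        exact DFunLike.congr_fun h x
    rw [Fintype.linearIndependent_iff] at hli ⊢
    intro g hg
    refine hli g ?_
    ext x
    have hx (j) : ∑ i, g i * σ i (b j) = 0 := by
      have := congrFun hg j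
      simp only [Finset.sum_apply, Pi.smul_apply] at this
      exact this
    rw [← b.sum_repr x]
    simp only [Finset.sum_apply, Pi.smul_apply, Pi.zero_apply, smul_eq_mul, MonoidHom.coe_coe,
      RingHom.coe_coe, map_sum, map_smul, Finset.mul_sum]
    rw [Finset.sum_comm]
    refine Finset.sum_eq_zero fun j _ ↦ ?_
    simp only [Algebra.smul_def, mul_left_comm (g _)]
    rw [← Finset.mul_sum, hx, mul_zero]
  obtain ⟨B, hB⟩ : ∃ B : Matrix (Fin (Module.finrank K L)) I k, A * B = 1 := by
    obtain ⟨g, hg⟩ := LinearMap.exists_leftInverse_of_injective A.vecMulLinear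
      (LinearMap.ker_eq_bot.mpr (Matrix.vecMul_injective_iff.mpr hA))
    refine ⟨Matrix.of fun j ↦ g (Pi.single j 1), ?_⟩
    ext i i'
    have h1 : g (A i) = Pi.single i 1 := by
      have := LinearMap.congr_fun hg (Pi.single i 1)
      rwa [LinearMap.comp_apply, Matrix.vecMulLinear_apply, Matrix.single_one_vecMul] at this
    rw [Matrix.one_eq_pi_single, ← h1, Matrix.mul_apply, LinearMap.pi_apply_eq_sum_univ,
      Finset.sum_apply]
    refine Finset.sum_congr rfl fun j _ ↦ ?_
    rw [Pi.smul_apply, smul_eq_mul, Matrix.of_apply]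
    have h2 : (fun l ↦ if j = l then (1 : k) else 0) = Pi.single j 1 := by
      ext l
      simp [Pi.single_apply, eq_comm]
    rw [h2]
  obtain ⟨i0⟩ := ‹Nonempty I›
  let T (i : I) : MvPolynomial (Fin (Module.finrank K L)) k :=
    ∑ j, MvPolynomial.C (A i j) * MvPolynomial.X j
  have hT : MvPolynomial.bind₁ T (P * MvPolynomial.X i0) ≠ 0 := by
    intro h0
    have h1 := congrArg (MvPolynomial.bind₁ fun j ↦
      ∑ i, MvPolynomial.C (B j i) * (MvPolynomial.X i : MvPolynomial I k)) h0
    rw [MvPolynomial.bind₁_bind₁, map_zero] at h1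
    have h2 : (fun i ↦ MvPolynomial.bind₁ (fun j ↦
        ∑ i, MvPolynomial.C (B j i) * (MvPolynomial.X i : MvPolynomial I k)) (T i)) =
        MvPolynomial.X := by
      ext1 i
      simp only [T, map_sum, map_mul, MvPolynomial.bind₁_X_right, MvPolynomial.bind₁_C_right,
        Finset.mul_sum, ← mul_assoc]
      rw [Finset.sum_comm]
      simp only [← Finset.sum_mul]
      have h3 (i₁ : I) : ∑ j, A i j * B j i₁ = (1 : Matrix I I k) i i₁ := by
        rw [← hB, Matrix.mul_apply]
      simp only [← map_mul, ← map_sum, h3]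
      simp [Matrix.one_apply]
    rw [h2] at h1
    simp [hP, MvPolynomial.X_ne_zero] at h1
  have hinf : (Set.range (algebraMap K k)).Infinite :=
    Set.infinite_range_of_injective (algebraMap K k).injective
  obtain ⟨x, hx, hne⟩ : ∃ x : Fin (Module.finrank K L) → k,
      (∀ j, x j ∈ Set.range (algebraMap K k)) ∧
      MvPolynomial.eval x (MvPolynomial.bind₁ T (P * MvPolynomial.X i0)) ≠ 0 := by
    by_contra! h
    exact hT (MvPolynomial.funext_set (fun _ ↦ Set.range (algebraMap K k)) (fun _ ↦ hinf)
      fun x hx ↦ by rw [h x fun j ↦ hx j trivial, map_zero])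
  choose x' hx' using hx
  have ht (i : I) : MvPolynomial.eval x (T i) = σ i (∑ j, x' j • b j) := by
    simp only [T, map_sum, map_mul, MvPolynomial.eval_C, MvPolynomial.eval_X,
      Algebra.smul_def, hx', AlgHom.commutes]
    exact Finset.sum_congr rfl fun _ _ ↦ mul_comm _ _
  have hev : MvPolynomial.eval x (MvPolynomial.bind₁ T (P * MvPolynomial.X i0)) =
      MvPolynomial.eval (fun i ↦ σ i (∑ j, x' j • b j)) (P * MvPolynomial.X i0) := by
    simp only [← ht]
    rw [← MvPolynomial.coe_aeval_eq_eval, ← MvPolynomial.coe_aeval_eq_eval]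
    simp only [RingHom.coe_coe, MvPolynomial.aeval_bind₁]
  rw [hev, map_mul, MvPolynomial.eval_X, mul_ne_zero_iff] at hne
  exact ⟨_, fun h ↦ hne.2 (by rw [h, map_zero]), hne.1⟩

theorem isSeparable_of_aeval_derivative_ne_zero {F E : Type*} [Field F] [Field E] [Algebra F E]
    {p : F[X]} {x : E} (hp : aeval x p = 0) (hp' : aeval x (derivative p) ≠ 0) :
    IsSeparable F x := by
  have hx : IsIntegral F x := by
    refine IsAlgebraic.isIntegral ⟨p, ?_, hp⟩
    rintro rfl
    simp at hp'
  refine (separable_iff_derivative_ne_zero (minpoly.irreducible hx)).mpr fun h0 ↦ hp' ?_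
  obtain ⟨g, rfl⟩ := minpoly.dvd F x hp
  simp [h0]

theorem Polynomial.Bivariate.coeff_coeff_swap {R : Type*} [CommSemiring R] (p : R[X][X]) (a b : ℕ) :
    ((Bivariate.swap p).coeff a).coeff b = (p.coeff b).coeff a := by
  induction p using Polynomial.induction_on' with
  | add p q hp hq => simp [hp, hq]
  | monomial n f =>
    induction f using Polynomial.induction_on' with
    | add p q hp hq => simp_all
    | monomial m r =>
      rw [Bivariate.swap_monomial_monomial]
      simp only [coeff_monomial]
      split_ifs <;> simp_all [coeff_monomial]

theorem Polynomial.natDegree_coeff_le_of_dvd {R : Type*} [CommRing R] [IsDomain R] {h G : R[X][X]}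
    (hG : G ≠ 0) (hdvd : h ∣ G) {D : ℕ} (hD : ∀ m, (G.coeff m).natDegree ≤ D) (m : ℕ) :
    (h.coeff m).natDegree ≤ D := by
  have h1 : (Bivariate.swap G).natDegree ≤ D := by
    rw [natDegree_le_iff_coeff_eq_zero]
    intro a ha
    ext b
    rw [Bivariate.coeff_coeff_swap, coeff_zero]
    exact coeff_eq_zero_of_natDegree_lt ((hD b).trans_lt ha)
  have h2 : (Bivariate.swap h).natDegree ≤ D := by
    obtain ⟨q, rfl⟩ := hdvd
    rw [map_mul] at h1
    refine (natDegree_le_of_dvd (Dvd.intro _ rfl) ?_).trans h1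
    rw [← map_mul]
    exact (EmbeddingLike.map_ne_zero_iff (f := Bivariate.swap (R := R))).mpr hG
  rw [natDegree_le_iff_coeff_eq_zero] at h2 ⊢
  intro a ha
  rw [← Bivariate.coeff_coeff_swap, h2 a ha, coeff_zero]

/-- The substitution `X ↦ θᵢ X` on polynomials. -/
noncomputable def genericScale {k I : Type*} [CommRing k] (i : I) :
    k[X] →+* (MvPolynomial I k)[X] :=
  eval₂RingHom (C.comp MvPolynomial.C) (C (MvPolynomial.X i) * X)

theorem genericRescale_algebraMap {k I : Type*} [CommRing k] (i : I) :
    (genericRescale i).comp (algebraMap k[X] k⟦X⟧) =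
      (algebraMap (MvPolynomial I k)[X] (MvPolynomial I k)⟦X⟧).comp (genericScale i) := by
  refine Polynomial.ringHom_ext (fun a ↦ PowerSeries.ext fun m ↦ ?_) (PowerSeries.ext fun m ↦ ?_)
  · change PowerSeries.coeff _ (genericRescale i ((C a : k[X]) : k⟦X⟧)) =
      PowerSeries.coeff _ (((genericScale i (C a) : (MvPolynomial I k)[X])) : (MvPolynomial I k)⟦X⟧)
    rcases m with _ | m <;> simp [genericScale, genericRescale, PowerSeries.coeff_C]
  · change PowerSeries.coeff _ (genericRescale i ((X : k[X]) : k⟦X⟧)) =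
      PowerSeries.coeff _ (((genericScale i X : (MvPolynomial I k)[X])) : (MvPolynomial I k)⟦X⟧)
    simp [genericScale, genericRescale, PowerSeries.coeff_X]

theorem aeval_genericRescale {k I : Type*} [CommRing k] (i : I) (p : k[X][X]) (η : k⟦X⟧) :
    aeval (genericRescale i η) (p.map (genericScale i)) = genericRescale i (aeval η p) := by
  rw [aeval_def, eval₂_map, aeval_def, hom_eval₂, genericRescale_algebraMap]

open IntermediateField in
theorem exists_natDegree_minpoly_genericRescale {K L k I : Type*} [Field K] [Infinite K] [Field L]
    [Field k] [Algebra K L] [Algebra K k] [Fintype I] (σ : I → L →ₐ[K] k)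
    (hσ : Function.Injective σ) (n : ℕ) (η : I → k⟦X⟧)
    (hη : ∀ i, LinearIndependent k[X] fun m : Fin n ↦ η i ^ (m : ℕ)) (p : I → k[X][X])
    (hp : ∀ i, aeval (η i) (p i) = 0) (hp' : ∀ i, aeval (η i) (derivative (p i)) ≠ 0) :
    ∃ w : L, LinearIndependent (MvPolynomial I k)[X] fun m : Fin (n ^ Fintype.card I) ↦
      (∑ i, PowerSeries.C (MvPolynomial.C (σ i w)) * genericRescale i (η i)) ^ (m : ℕ) := by
  classical
  let R := MvPolynomial I k
  let E := FractionRing R⟦X⟧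
  let M := FractionRing R[X]
  have hinj : Function.Injective (algebraMap R[X] R⟦X⟧) := Polynomial.coe_injective _
  have hinj' : Function.Injective (algebraMap R⟦X⟧ E) := IsFractionRing.injective _ _
  have : FaithfulSMul R[X] E := (faithfulSMul_iff_algebraMap_injective R[X] E).mpr (by
    rw [IsScalarTower.algebraMap_eq R[X] R⟦X⟧ E]
    exact hinj'.comp hinj)
  let : Algebra M E := FractionRing.liftAlgebra R[X] E
  have : IsScalarTower R[X] M E := FractionRing.isScalarTower_liftAlgebra R[X] E
  let Y (i : I) : E := algebraMap R⟦X⟧ E (genericRescale i (η i))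
  have hroot (i : I) (q : k[X][X]) : aeval (Y i) ((q.map (genericScale i)).map (algebraMap R[X] M)) =
      algebraMap R⟦X⟧ E (genericRescale i (aeval (η i) q)) := by
    rw [aeval_map_algebraMap, aeval_algebraMap_apply, aeval_genericRescale]
  have hsep (i : I) : IsSeparable M (Y i) := by
    refine isSeparable_of_aeval_derivative_ne_zero
      (p := ((p i).map (genericScale i)).map (algebraMap R[X] M)) ?_ ?_
    · rw [hroot, hp, map_zero, map_zero]
    · rw [derivative_map, derivative_map, hroot, Ne, map_eq_zero_iff _ hinj',
        map_eq_zero_iff _ (genericRescale_injective i)]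
      exact hp' i
  let F := adjoin M (Set.range Y)
  have : FiniteDimensional M F := finiteDimensional_adjoin (by
    rintro _ ⟨i, rfl⟩; exact (hsep i).isIntegral)
  have : Algebra.IsSeparable M F := (isSeparable_adjoin_iff_isSeparable M E).mpr (by
    rintro _ ⟨i, rfl⟩; exact hsep i)
  let Y' (i : I) : F := ⟨Y i, subset_adjoin _ _ ⟨i, rfl⟩⟩
  obtain ⟨w, hw⟩ := exists_adjoin_sum_eq_top (M := M) σ hσ Y' fun φ ψ h ↦
    algHom_ext_of_eq_adjoin M rfl (by rintro _ ⟨i, rfl⟩; exact h i)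
  refine ⟨w, ?_⟩
  set z := ∑ i, PowerSeries.C (MvPolynomial.C (σ i w)) * genericRescale i (η i)
  set z' : F := ∑ i, algebraMap M F (algebraMap k M (σ i w)) * Y' i
  have hz : (z' : E) = algebraMap R⟦X⟧ E z := by
    have h (a : k) : algebraMap M E (algebraMap k M a) =
        algebraMap R⟦X⟧ E (PowerSeries.C (MvPolynomial.C a)) := by
      rw [IsScalarTower.algebraMap_apply k R[X] M, ← IsScalarTower.algebraMap_apply R[X] M E,
        IsScalarTower.algebraMap_apply R[X] R⟦X⟧ E]
      exact congrArg _ (Polynomial.coe_C _)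
    rw [map_sum, ← F.coe_val, map_sum]
    refine Finset.sum_congr rfl fun i _ ↦ ?_
    rw [map_mul, map_mul, AlgHom.commutes, h]
    rfl
  have hfin : n ^ Fintype.card I ≤ (minpoly M z').natDegree := by
    rw [(Field.primitive_element_iff_minpoly_natDegree_eq M z').mp hw]
    obtain ⟨ι, _, v, hcard, hv, hvmem⟩ := exists_linearIndependent_genericRescale n η hη Finset.univ
    have hv1 := hv.map_injOn (IsScalarTower.toAlgHom R[X] R⟦X⟧ E).toLinearMap hinj'.injOn
    have hv2 := (LinearIndependent.iff_fractionRing R[X] M).mp hv1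
    have hvF (s : ι) : algebraMap R⟦X⟧ E (v s) ∈ F := by
      have : Algebra.adjoin R[X] ((fun i ↦ genericRescale i (η i)) '' (Finset.univ : Finset I)) ≤
          (F.toSubalgebra.restrictScalars R[X]).comap (IsScalarTower.toAlgHom R[X] R⟦X⟧ E) := by
        rw [Algebra.adjoin_le_iff]
        rintro _ ⟨i, -, rfl⟩
        exact subset_adjoin _ _ ⟨i, rfl⟩
      exact this (hvmem s)
    have hv3 : LinearIndependent M fun s ↦ (⟨_, hvF s⟩ : F) :=
      LinearIndependent.of_comp F.val.toLinearMap hv2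
    rw [← Finset.card_univ, ← hcard]
    exact hv3.fintype_card_le_finrank
  have h1 := (linearIndependent_pow (K := M) z').comp (Fin.castLE hfin) (Fin.castLE_injective hfin)
  have h2 := (LinearIndependent.iff_fractionRing R[X] M).mpr
    (h1.map_injOn F.val.toLinearMap F.val.injective.injOn)
  refine LinearIndependent.of_comp (IsScalarTower.toAlgHom R[X] R⟦X⟧ E).toLinearMap ?_
  have h3 (m : ℕ) : algebraMap R⟦X⟧ E (z ^ m) = ((z' ^ m : F) : E) := by
    rw [map_pow, ← hz]
    rfl
  have h4 : (IsScalarTower.toAlgHom R[X] R⟦X⟧ E).toLinearMap ∘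
      (fun m : Fin (n ^ Fintype.card I) ↦ z ^ (m : ℕ)) =
        fun m : Fin (n ^ Fintype.card I) ↦ ((z' ^ (m : ℕ) : F) : E) :=
    funext fun m ↦ h3 m
  rw [h4]
  exact h2

theorem linearIndependent_X_pow_mul {R : Type*} [CommRing R] {N : ℕ} {z : R⟦X⟧}
    (hz : LinearIndependent R[X] fun m : Fin N ↦ z ^ (m : ℕ)) (D : ℕ) :
    LinearIndependent R fun q : Fin D × Fin N ↦
      (PowerSeries.X ^ (q.1 : ℕ) * z ^ (q.2 : ℕ) : R⟦X⟧) := by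
  have h0 := (basisMonomials R).linearIndependent.comp (fun j : Fin D ↦ (j : ℕ)) Fin.val_injective
  have h1 := linearIndependent_smul h0 hz
  convert h1 using 2 with q
  simp only [Function.comp_apply, coe_basisMonomials, monomial_one_right_eq_X_pow, Algebra.smul_def]
  congr 1
  exact ((Polynomial.coe_pow _).trans (by rw [Polynomial.coe_X])).symm

theorem aeval_powerSeries_eq_sum {k : Type*} [CommRing k] {h : k[X][X]} {D N : ℕ}
    (hD : ∀ m, (h.coeff m).natDegree < D) (hN : h.natDegree < N) (z : k⟦X⟧) :
    aeval z h = ∑ q : Fin D × Fin N,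
      (h.coeff q.2).coeff q.1 • (PowerSeries.X ^ (q.1 : ℕ) * z ^ (q.2 : ℕ)) := by
  rw [Fintype.sum_prod_type_right, aeval_eq_sum_range' hN,
    ← Fin.sum_univ_eq_sum_range (fun i ↦ h.coeff i • z ^ i)]
  refine Finset.sum_congr rfl fun m _ ↦ ?_
  simp only [← smul_mul_assoc, ← Finset.sum_mul]
  rw [Algebra.smul_def]
  congr 1
  change ((h.coeff m : k[X]) : k⟦X⟧) = _
  conv_lhs => rw [as_sum_range' (h.coeff m) D (hD m)]
  rw [← Fin.sum_univ_eq_sum_range (fun i ↦ monomial i ((h.coeff m).coeff i)),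
    ← Polynomial.coeToPowerSeries.ringHom_apply, map_sum]
  refine Finset.sum_congr rfl fun j _ ↦ ?_
  rw [Polynomial.coeToPowerSeries.ringHom_apply, Polynomial.coe_monomial, PowerSeries.smul_eq_C_mul,
    PowerSeries.monomial_eq_mk]
  ext l
  simp [PowerSeries.coeff_X_pow]

theorem exists_natDegree_minpoly_sum_rescale {K L k I : Type*} [Field K] [Infinite K] [Field L]
    [Field k] [Algebra K L] [Algebra K k] [FiniteDimensional K L] [Fintype I] [Nonempty I]
    (σ : I → L →ₐ[K] k) (hσ : Function.Injective σ) (n : ℕ) (η : I → k⟦X⟧)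
    (hη : ∀ i, LinearIndependent k[X] fun m : Fin n ↦ η i ^ (m : ℕ)) (p : I → k[X][X])
    (hmonic : ∀ i, (p i).Monic)
    (hp : ∀ i, aeval (η i) (p i) = 0) (hp' : ∀ i, aeval (η i) (derivative (p i)) ≠ 0) :
    ∃ w t : L, t ≠ 0 ∧ n ^ Fintype.card I ≤
      (minpoly k[X] (∑ i, PowerSeries.C (σ i w) * PowerSeries.rescale (σ i t) (η i))).natDegree := by
  obtain ⟨w, hw⟩ := exists_natDegree_minpoly_genericRescale σ hσ n η hη p hp hp'
  set z : (MvPolynomial I k)⟦X⟧ :=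
    ∑ i, PowerSeries.C (MvPolynomial.C (σ i w)) * genericRescale i (η i) with hzdef
  have hz : IsIntegral (MvPolynomial I k)[X] z := by
    refine IsIntegral.sum _ fun i _ ↦ IsIntegral.mul ?_ ?_
    · rw [← Polynomial.coe_C]
      exact isIntegral_algebraMap (x := C (MvPolynomial.C (σ i w)))
    · exact ⟨(p i).map (genericScale i), (hmonic i).map _, by
        rw [← aeval_def, aeval_genericRescale, hp, map_zero]⟩
  obtain ⟨G, hG, hGz⟩ := hz
  let D := G.support.sup fun m ↦ (G.coeff m).natDegree
  have hD (m : ℕ) : (G.coeff m).natDegree ≤ D := by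
    by_cases hm : m ∈ G.support
    · exact Finset.le_sup (f := fun m ↦ (G.coeff m).natDegree) hm
    · simp [notMem_support_iff.mp hm]
  obtain ⟨P, hP, hPe⟩ := exists_linearIndependent_powerSeries_map (k := k)
    (linearIndependent_X_pow_mul hw (D + 1))
  obtain ⟨t, ht, htP⟩ := exists_eval_algHom_ne_zero σ hσ hP
  refine ⟨w, t, ht, ?_⟩
  let e : MvPolynomial I k →+* k := MvPolynomial.eval fun i ↦ σ i t
  have hez : PowerSeries.map e z =
      ∑ i, PowerSeries.C (σ i w) * PowerSeries.rescale (σ i t) (η i) := by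
    rw [hzdef, map_sum]
    refine Finset.sum_congr rfl fun i _ ↦ ?_
    ext l
    simp [e, coeff_genericRescale, PowerSeries.coeff_rescale]
  rw [← hez]
  have hli := hPe e htP
  simp only [map_mul, map_pow, PowerSeries.map_X] at hli
  have hG' : (G.map (mapRingHom e)).Monic := hG.map _
  have hGz' : aeval (PowerSeries.map e z) (G.map (mapRingHom e)) = 0 := by
    rw [aeval_def, eval₂_map, ← map_zero (PowerSeries.map e), ← hGz, hom_eval₂]
    congr 1
    exact RingHom.ext fun q ↦ Polynomial.polynomial_map_coe (φ := e) (f := q)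
  have h_int : IsIntegral k[X] (PowerSeries.map e z) := ⟨_, hG', hGz'⟩
  set h := minpoly k[X] (PowerSeries.map e z)
  have : Module.IsTorsionFree k[X] k⟦X⟧ :=
    Module.isTorsionFree_iff_algebraMap_injective.mpr (Polynomial.coe_injective k)
  have hdvd : h ∣ G.map (mapRingHom e) := minpoly.isIntegrallyClosed_dvd h_int hGz'
  have hhD (m : ℕ) : (h.coeff m).natDegree < D + 1 := by
    refine Nat.lt_succ_of_le (natDegree_coeff_le_of_dvd hG'.ne_zero hdvd (fun m ↦ ?_) m)
    rw [coeff_map]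
    exact natDegree_map_le.trans (hD m)
  by_contra! hlt
  have h0 := (Fintype.linearIndependent_iff.mp hli) (fun q ↦ (h.coeff q.2).coeff q.1)
    (by rw [← aeval_powerSeries_eq_sum hhD hlt, minpoly.aeval]) (0, ⟨h.natDegree, hlt⟩)
  simp [coeff_natDegree, (minpoly.monic h_int).leadingCoeff, h] at h0

theorem irreducible_integralNormalization_of_field {F : Type*} [Field F] {p : F[X]}
    (hp : Irreducible p) : Irreducible p.integralNormalization := by
  have hc : p.leadingCoeff ≠ 0 := leadingCoeff_ne_zero.mpr hp.ne_zero
  let := invertibleOfNonzero (inv_ne_zero hc)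
  have h1 : Irreducible (p.comp (C p.leadingCoeff⁻¹ * X)) := by
    have := hp.map (algEquivCMulXAddC p.leadingCoeff⁻¹ 0)
    simpa [aeval_def, comp] using this
  have hn : 0 < p.natDegree := hp.natDegree_pos
  have h2 : p.integralNormalization =
      C (p.leadingCoeff ^ (p.natDegree - 1)) * p.comp (C p.leadingCoeff⁻¹ * X) := by
    ext i
    rw [integralNormalization_coeff, coeff_C_mul, comp_C_mul_X_coeff]
    split_ifs with h
    · obtain rfl := natDegree_eq_of_degree_eq_some h
      rw [coeff_natDegree, ← pow_sub_one_mul hn.ne' p.leadingCoeff⁻¹]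
      field_simp
      rw [← mul_pow, mul_one_div_cancel hc, one_pow]
    · rcases lt_trichotomy i p.natDegree with hi | hi | hi
      · rw [mul_left_comm]
        congr 1
        rw [inv_pow, ← pow_sub₀ _ hc (by lia)]
      · exact absurd (hi ▸ degree_eq_natDegree hp.ne_zero) h
      · simp [coeff_eq_zero_of_natDegree_lt hi]
  rw [h2, irreducible_isUnit_mul (isUnit_C.mpr (pow_ne_zero _ hc).isUnit)]
  exact h1

theorem irreducible_integralNormalization {R : Type*} [CommRing R] [IsDomain R]
    [NormalizedGCDMonoid R] {p : R[X]} (hp : Irreducible p) (hn : p.natDegree ≠ 0) :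
    Irreducible p.integralNormalization := by
  have h1 := (hp.isPrimitive hn).irreducible_iff_irreducible_map_fraction_map
    (K := FractionRing R) |>.mp hp
  rw [(monic_integralNormalization hp.ne_zero).irreducible_iff_irreducible_map_fraction_map
    (K := FractionRing R), ← integralNormalization_map]
  · exact irreducible_integralNormalization_of_field h1
  · rw [Ne, IsFractionRing.to_map_eq_zero_iff]
    exact leadingCoeff_ne_zero.mpr hp.ne_zero

theorem derivative_integralNormalization_ne_zero {R : Type*} [CommRing R] [IsDomain R]
    {p : R[X]} (hp : derivative p ≠ 0) : derivative p.integralNormalization ≠ 0 := by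
  obtain ⟨i, hi⟩ : ∃ i, (derivative p).coeff i ≠ 0 := by
    by_contra! h
    exact hp (Polynomial.ext h)
  have hp0 : p ≠ 0 := by
    rintro rfl
    simp at hp
  refine fun h ↦ hi ?_
  have h' := congrArg (coeff · i) h
  simp only [coeff_derivative, coeff_zero, integralNormalization_coeff] at h' ⊢
  split_ifs at h' with hdeg
  · rw [one_mul] at h'
    rw [h', mul_zero]
  · rw [mul_right_comm] at h'
    exact (mul_eq_zero.mp h').resolve_right (pow_ne_zero _ (leadingCoeff_ne_zero.mpr hp0))

theorem exists_mul_add_mul_derivative_eq_C {R : Type*} [CommRing R] [IsDomain R]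
    [IsIntegrallyClosed R] {p : R[X]} (hm : p.Monic) (hp : Irreducible p)
    (hp' : derivative p ≠ 0) :
    ∃ (u v : R[X]) (r : R), r ≠ 0 ∧ u * p + v * derivative p = C r := by
  let F := FractionRing R
  have hinj : Function.Injective (algebraMap R F) := IsFractionRing.injective R F
  have h1 := (hm.irreducible_iff_irreducible_map_fraction_map (K := F)).mp hp
  have h2 : (p.map (algebraMap R F)).Separable := by
    rw [separable_iff_derivative_ne_zero h1, derivative_map, Ne,
      Polynomial.map_eq_zero_iff hinj]
    exact hp'
  obtain ⟨a, b, hab⟩ := h2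
  obtain ⟨c, hc, hac⟩ := IsLocalization.integerNormalization_spec (nonZeroDivisors R) a
  obtain ⟨d, hd, hbd⟩ := IsLocalization.integerNormalization_spec (nonZeroDivisors R) b
  refine ⟨C d * IsLocalization.integerNormalization (nonZeroDivisors R) a,
    C c * IsLocalization.integerNormalization (nonZeroDivisors R) b, c * d,
    mul_ne_zero (nonZeroDivisors.ne_zero hc) (nonZeroDivisors.ne_zero hd), ?_⟩
  refine map_injective _ hinj ?_
  simp only [Polynomial.map_add, Polynomial.map_mul, hac, hbd, ← derivative_map, map_C, map_mul]
  simp only [Algebra.smul_def, Polynomial.algebraMap_apply]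
  change C (algebraMap R F d) * (C (algebraMap R F c) * a) * _ +
    C (algebraMap R F c) * (C (algebraMap R F d) * b) * _ = _
  linear_combination C (algebraMap R F c) * C (algebraMap R F d) * hab

theorem exists_powerSeries_root_of_constantCoeff {k : Type*} [Field k] {p : k[X][X]} (hp : p.Monic)
    {y : k} (hy : eval y (p.map (evalRingHom 0)) = 0)
    (hy' : eval y (derivative (p.map (evalRingHom 0))) ≠ 0) :
    ∃ η : k⟦X⟧, aeval η p = 0 ∧ aeval η (derivative p) ≠ 0 := by
  have hcomp : (PowerSeries.constantCoeff (R := k)).comp (algebraMap k[X] k⟦X⟧) =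
      evalRingHom 0 := by
    refine RingHom.ext fun q ↦ ?_
    change PowerSeries.constantCoeff (q : k⟦X⟧) = eval 0 q
    rw [← PowerSeries.coeff_zero_eq_constantCoeff_apply, Polynomial.coeff_coe,
      coeff_zero_eq_eval_zero]
  have hcc (q : k[X][X]) (x : k⟦X⟧) : PowerSeries.constantCoeff (aeval x q) =
      eval (PowerSeries.constantCoeff x) (q.map (evalRingHom 0)) := by
    rw [aeval_def, hom_eval₂, hcomp, eval_map]
  have := HenselianRing.is_henselian (I := Ideal.span {(PowerSeries.X : k⟦X⟧)})
    (p.map (algebraMap _ _)) (hp.map _) (PowerSeries.C y) ?_ ?_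
  · obtain ⟨η, hη, hη'⟩ := this
    rw [Ideal.mem_span_singleton, PowerSeries.X_dvd_iff, map_sub, PowerSeries.constantCoeff_C,
      sub_eq_zero] at hη'
    refine ⟨η, by rwa [IsRoot, eval_map_algebraMap] at hη, fun h ↦ hy' ?_⟩
    rw [derivative_map, ← hη', ← hcc, h, map_zero]
  · rw [Ideal.mem_span_singleton, PowerSeries.X_dvd_iff, eval_map_algebraMap, hcc,
      PowerSeries.constantCoeff_C, hy]
  · refine IsUnit.map _ ?_
    rw [PowerSeries.isUnit_iff_constantCoeff, derivative_map, eval_map_algebraMap, hcc,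
      PowerSeries.constantCoeff_C, ← derivative_map]
    exact hy'.isUnit

theorem minpoly_eq_of_irreducible_of_isIntegrallyClosed {R S : Type*} [CommRing R] [IsDomain R]
    [IsIntegrallyClosed R] [CommRing S] [IsDomain S] [Algebra R S] [Module.IsTorsionFree R S]
    {x : S} {p : R[X]} (hm : p.Monic) (hp : Irreducible p) (hx : aeval x p = 0) :
    minpoly R x = p := by
  have h_int : IsIntegral R x := ⟨p, hm, hx⟩
  refine eq_of_monic_of_associated (minpoly.monic h_int) hm ?_
  exact (minpoly.irreducible h_int).associated_of_dvd hp (minpoly.isIntegrallyClosed_dvd h_int hx)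

theorem linearIndependent_pow_of_natDegree_minpoly {R S : Type*} [CommRing R] [IsDomain R]
    [IsIntegrallyClosed R] [CommRing S] [IsDomain S] [Algebra R S] [Module.IsTorsionFree R S]
    {x : S} (hx : IsIntegral R x) :
    LinearIndependent R fun m : Fin (minpoly R x).natDegree ↦ x ^ (m : ℕ) := by
  rw [Fintype.linearIndependent_iff]
  intro g hg
  let q : R[X] := ∑ m : Fin _, monomial (m : ℕ) (g m)
  have hq : aeval x q = 0 := by
    simpa [q, aeval_monomial, ← Algebra.smul_def] using hg
  have hdeg : q.degree < (minpoly R x).degree := by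
    rw [degree_eq_natDegree (minpoly.ne_zero hx)]
    refine degree_lt_iff_coeff_zero _ _ |>.mpr fun m hm ↦ ?_
    simp only [q, finsetSum_coeff, coeff_monomial]
    exact Finset.sum_eq_zero fun j _ ↦ if_neg (by lia)
  have h0 : q = 0 := by
    by_contra h
    exact absurd (degree_le_of_dvd (minpoly.isIntegrallyClosed_dvd hx hq) h) (not_le.mpr hdeg)
  intro i
  have := congrArg (coeff · (i : ℕ)) h0
  simpa [q, finsetSum_coeff, coeff_monomial, Fin.val_inj] using this
theorem irreducible_map_compRingHom {k : Type*} [Field k] {p : k[X][X]} (hp : Irreducible p)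
    {t : k} (ht : t ≠ 0) (a : k) : Irreducible (p.map (compRingHom (C t * X + C a))) := by
  let := invertibleOfNonzero ht
  have h := hp.map (mapEquiv (algEquivCMulXAddC t a).toRingEquiv)
  have h' : compRingHom (C t * X + C a) = ((algEquivCMulXAddC t a).toRingEquiv : k[X] →+* k[X]) :=
    RingHom.ext fun q ↦ by simp [comp, aeval_def]
  rw [h']
  exact h

theorem aeval_rescale_map_compRingHom {k : Type*} [Field k] (p : k[X][X]) (t a : k) (η : k⟦X⟧) :
    aeval (PowerSeries.rescale t η) (p.map (compRingHom (C t * X + C a))) =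
      PowerSeries.rescale t (aeval η (p.map (compRingHom (C 1 * X + C a)))) := by
  rw [aeval_def, aeval_def, eval₂_map, eval₂_map, hom_eval₂]
  congr 1
  have hX : algebraMap k[X] k⟦X⟧ X = PowerSeries.X := Polynomial.coe_X
  have hC (c : k) : algebraMap k[X] k⟦X⟧ (C c) = PowerSeries.C c := Polynomial.coe_C c
  have hrX : PowerSeries.rescale t (PowerSeries.X : k⟦X⟧) = PowerSeries.C t * PowerSeries.X := by
    ext l
    rcases eq_or_ne l 1 with rfl | hl <;>
      simp_all [PowerSeries.coeff_X]
  have hrC (c : k) : PowerSeries.rescale t (PowerSeries.C c) = PowerSeries.C c := by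
    ext l
    rcases l with _ | l <;> simp [PowerSeries.coeff_rescale, PowerSeries.coeff_C]
  refine Polynomial.ringHom_ext (fun c ↦ ?_) ?_
  · simp [hC, hrC]
  · simp [hC, hX, hrX, hrC]

theorem exists_powerSeries_root {k : Type*} [Field k] [IsAlgClosed k] {p : k[X][X]} (hm : p.Monic)
    (hp : Irreducible p) (hp' : derivative p ≠ 0) :
    ∃ r : k[X], r ≠ 0 ∧ ∀ a, r.eval a ≠ 0 → ∃ η : k⟦X⟧,
      (LinearIndependent k[X] fun m : Fin p.natDegree ↦ η ^ (m : ℕ)) ∧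
      aeval η (p.map (compRingHom (C 1 * X + C a))) = 0 ∧
      aeval η (derivative (p.map (compRingHom (C 1 * X + C a)))) ≠ 0 := by
  obtain ⟨u, v, r, hr, huv⟩ := exists_mul_add_mul_derivative_eq_C hm hp hp'
  refine ⟨r, hr, fun a ha ↦ ?_⟩
  have hn : p.natDegree ≠ 0 := fun h ↦ hp' (derivative_of_natDegree_zero h)
  have hcomp : (evalRingHom 0).comp (compRingHom (C 1 * X + C a)) = evalRingHom a :=
    Polynomial.ringHom_ext (fun c ↦ by simp) (by simp)
  obtain ⟨y, hy⟩ := IsAlgClosed.exists_root (p.map (evalRingHom a))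
    (degree_ne_of_natDegree_ne (by rwa [hm.natDegree_map]))
  have hy' : eval y (derivative (p.map (evalRingHom a))) ≠ 0 := fun h ↦ ha <| by
    have := congrArg (fun q ↦ eval y (q.map (evalRingHom a))) huv
    rw [derivative_map] at h
    simpa [hy.eq_zero, h] using this.symm
  have hm' := hm.map (compRingHom (C 1 * X + C a))
  obtain ⟨η, h1, h2⟩ := exists_powerSeries_root_of_constantCoeff hm'
    (by rwa [Polynomial.map_map, hcomp]) (by rwa [Polynomial.map_map, hcomp])
  refine ⟨η, ?_, h1, h2⟩
  have : Module.IsTorsionFree k[X] k⟦X⟧ :=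
    Module.isTorsionFree_iff_algebraMap_injective.mpr (Polynomial.coe_injective k)
  have h3 := linearIndependent_pow_of_natDegree_minpoly (R := k[X]) ⟨_, hm', h1⟩
  rwa [minpoly_eq_of_irreducible_of_isIntegrallyClosed hm'
    (irreducible_map_compRingHom hp one_ne_zero a) h1, hm.natDegree_map] at h3

theorem natDegree_minpoly_le_card {E Ω : Type*} [Field E] [Field Ω] [Algebra E Ω] [Normal E Ω]
    {x : Ω} (hx : IsSeparable E x) (S : Finset Ω) (hS : ∀ τ : Ω ≃ₐ[E] Ω, τ x ∈ S) :
    (minpoly E x).natDegree ≤ S.card := by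
  classical
  rw [← card_rootSet_eq_natDegree hx (Normal.splits ‹_› x), ← Fintype.card_coe S]
  refine Fintype.card_le_of_injective (fun r ↦ ⟨r.1, ?_⟩) fun r s h ↦ by
    simpa [Subtype.ext_iff] using h
  obtain ⟨r, hr⟩ := r
  obtain ⟨τ, hτ⟩ := (isConjRoot_iff_exists_algEquiv (K := E)).mp
    ((isConjRoot_iff_mem_minpoly_rootSet hx.isIntegral).mpr hr).symm
  exact hτ ▸ hS τ

theorem mem_range_algebraMap_of_forall_algEquiv {E Ω : Type*} [Field E] [Field Ω] [Algebra E Ω]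
    [Normal E Ω] {x : Ω} (hx : IsSeparable E x) (h : ∀ τ : Ω ≃ₐ[E] Ω, τ x = x) :
    x ∈ (algebraMap E Ω).range := by
  have h1 := natDegree_minpoly_le_card hx {x} (by simpa using h)
  have h2 := minpoly.natDegree_pos hx.isIntegral
  exact minpoly.natDegree_eq_one_iff.mp (by simp at h1; lia)

theorem exists_conj_tuple {K L C Ω : Type*} [Field K] [Field L] [Field C] [Field Ω] [Algebra K L]
    [Algebra K C] [Normal K C] [Algebra C Ω] [Algebra K Ω] [IsScalarTower K C Ω] [Algebra C[X] Ω]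
    [IsScalarTower C C[X] Ω] [Fintype (L →ₐ[K] C)] (P : L[X][X]) (w : L) (τ : Ω →ₐ[K] Ω)
    (hτ : τ (algebraMap C[X] Ω X) = algebraMap C[X] Ω X) (y : (L →ₐ[K] C) → Ω)
    (hy : ∀ σ : L →ₐ[K] C, aeval (y σ) (P.map (mapRingHom σ.toRingHom)) = 0) :
    ∃ y' : (L →ₐ[K] C) → Ω,
      (∀ σ : L →ₐ[K] C, aeval (y' σ) (P.map (mapRingHom σ.toRingHom)) = 0) ∧
      τ (∑ σ, algebraMap C Ω (σ w) * y σ) = ∑ σ, algebraMap C Ω (σ w) * y' σ ∧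
      ∀ σ : L →ₐ[K] C, (∀ x, τ (algebraMap C Ω (σ x)) = algebraMap C Ω (σ x)) →
        y' σ = τ (y σ) := by
  classical
  let ρ : C →ₐ[K] C := τ.restrictNormal C
  have hρ (c : C) : algebraMap C Ω (ρ c) = τ (algebraMap C Ω c) := τ.restrictNormal_commutes C c
  let π : (L →ₐ[K] C) → (L →ₐ[K] C) := fun σ ↦ ρ.comp σ
  have hπ : Function.Bijective π := Function.Injective.bijective_of_finite fun σ σ' h ↦
    AlgHom.ext fun x ↦ ρ.injective (DFunLike.congr_fun h x)
  let π' := Equiv.ofBijective π hπ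
  have hround (σ : L →ₐ[K] C) : π'.symm (π σ) = σ := π'.symm_apply_apply σ
  refine ⟨fun σ ↦ τ (y (π'.symm σ)), fun σ ↦ ?_, ?_, fun σ hσ ↦ ?_⟩
  · obtain ⟨σ, rfl⟩ := hπ.surjective σ
    have hcomp : (algebraMap C[X] Ω).comp (mapRingHom (π σ).toRingHom) =
        (τ : Ω →+* Ω).comp ((algebraMap C[X] Ω).comp (mapRingHom σ.toRingHom)) := by
      refine Polynomial.ringHom_ext (fun a ↦ ?_) ?_
      · have hC (c : C) : algebraMap C[X] Ω (Polynomial.C c) = algebraMap C Ω c :=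
          (IsScalarTower.algebraMap_apply C C[X] Ω c).symm
        simp only [RingHom.comp_apply, coe_mapRingHom, map_C, hC]
        exact hρ (σ a)
      · simpa using hτ.symm
    beta_reduce
    rw [hround, aeval_def, eval₂_map, hcomp, ← AlgHom.coe_toRingHom τ, ← hom_eval₂, ← eval₂_map,
      ← aeval_def, hy, map_zero]
  · rw [map_sum]
    refine (Finset.sum_congr rfl fun σ _ ↦ ?_).trans
      (Equiv.sum_comp π' fun σ ↦ algebraMap C Ω (σ w) * τ (y (π'.symm σ)))
    rw [map_mul, ← hρ, Equiv.symm_apply_apply]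
    rfl
  · have : π σ = σ := AlgHom.ext fun x ↦ (algebraMap C Ω).injective ((hρ _).trans (hσ x))
    beta_reduce
    rw [← this, hround, this]

theorem aeval_derivative_ne_zero_of_irreducible {R S : Type*} [CommRing R] [IsDomain R]
    [IsIntegrallyClosed R] [CommRing S] [IsDomain S] [Algebra R S] [Module.IsTorsionFree R S]
    {x : S} {p : R[X]} (hm : p.Monic) (hp : Irreducible p) (hp' : derivative p ≠ 0)
    (hx : aeval x p = 0) : aeval x (derivative p) ≠ 0 := fun h ↦ by
  have h1 := minpoly.isIntegrallyClosed_dvd ⟨p, hm, hx⟩ h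
  rw [minpoly_eq_of_irreducible_of_isIntegrallyClosed hm hp hx] at h1
  exact hp' (eq_zero_of_dvd_of_degree_lt h1 (degree_derivative_lt hp.ne_zero))

theorem isIntegral_algebraMap_polynomial {K C Ω : Type*} [Field K] [Field C] [Field Ω]
    [Algebra K C] [Algebra.IsAlgebraic K C] [Algebra K[X] Ω] [Algebra C[X] Ω]
    (hK : (algebraMap C[X] Ω).comp (mapRingHom (algebraMap K C)) = algebraMap K[X] Ω) (p : C[X]) :
    IsIntegral K[X] (algebraMap C[X] Ω p) := by
  have hK' (q : K[X]) : algebraMap C[X] Ω (q.map (algebraMap K C)) = algebraMap K[X] Ω q :=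
    RingHom.congr_fun hK q
  have hX : IsIntegral K[X] (algebraMap C[X] Ω X) := by
    have := hK' X
    rw [map_X] at this
    exact this ▸ isIntegral_algebraMap
  have hC (c : C) : IsIntegral K[X] (algebraMap C[X] Ω (Polynomial.C c)) := by
    obtain ⟨q, hq, hq'⟩ := Algebra.IsIntegral.isIntegral (R := K) c
    refine ⟨q.map Polynomial.C, hq.map _, ?_⟩
    have hcomp : (algebraMap K[X] Ω).comp Polynomial.C =
        ((algebraMap C[X] Ω).comp Polynomial.C).comp (algebraMap K C) := by
      ext a
      simp [← hK]
    rw [eval₂_map, hcomp]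
    change eval₂ _ (((algebraMap C[X] Ω).comp Polynomial.C) c) q = 0
    rw [← hom_eval₂, hq', map_zero]
  induction p using Polynomial.induction_on' with
  | add p q hp hq => rw [map_add]; exact hp.add hq
  | monomial n c =>
    rw [← C_mul_X_pow_eq_monomial, map_mul, map_pow]
    exact (hC c).mul (hX.pow n)

theorem isIntegral_polynomial_trans {K C Ω : Type*} [Field K] [Field C] [Field Ω]
    [Algebra K C] [Algebra.IsAlgebraic K C] [Algebra K[X] Ω] [Algebra C[X] Ω]
    (hK : (algebraMap C[X] Ω).comp (mapRingHom (algebraMap K C)) = algebraMap K[X] Ω) {x : Ω}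
    (hx : IsIntegral C[X] x) : IsIntegral K[X] x := by
  let := (mapRingHom (algebraMap K C)).toAlgebra
  have : IsScalarTower K[X] C[X] Ω := .of_algebraMap_eq' hK.symm
  have : IsIntegral (integralClosure K[X] Ω) x := by
    obtain ⟨p, hp, hpx⟩ := hx
    let g : C[X] →+* integralClosure K[X] Ω :=
      (algebraMap C[X] Ω).codRestrict (integralClosure K[X] Ω)
        (isIntegral_algebraMap_polynomial hK)
    refine ⟨p.map g, hp.map g, ?_⟩
    rw [eval₂_map]
    exact hpx
  exact isIntegral_trans x this

open IntermediateField in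
theorem exists_separable_generator {K L C Ω FK FL FC : Type*} [Field K] [Field L] [Field C]
    [Field Ω] [Field FK] [Field FL] [Field FC] [Algebra K L] [Algebra K C] [Algebra L C]
    [IsScalarTower K L C] [Fintype (L →ₐ[K] C)] [Normal K C]
    [Algebra K Ω] [Algebra C Ω] [IsScalarTower K C Ω]
    [Algebra K[X] Ω] [Algebra L[X] Ω] [Algebra C[X] Ω] [IsScalarTower C C[X] Ω]
    [FaithfulSMul C[X] Ω]
    [Algebra K[X] FK] [IsFractionRing K[X] FK] [Algebra FK Ω] [IsScalarTower K[X] FK Ω]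
    [Algebra L[X] FL] [IsFractionRing L[X] FL] [Algebra FL Ω] [IsScalarTower L[X] FL Ω]
    [Algebra C[X] FC] [IsFractionRing C[X] FC] [Algebra FC Ω] [IsScalarTower C[X] FC Ω]
    [Normal FK Ω] [Normal FL Ω] [Normal FC Ω]
    (hK : (algebraMap C[X] Ω).comp (mapRingHom (algebraMap K C)) = algebraMap K[X] Ω)
    (hL : (algebraMap C[X] Ω).comp (mapRingHom (algebraMap L C)) = algebraMap L[X] Ω)
    {P : L[X][X]} (hm : P.Monic) (hP' : derivative P ≠ 0)
    (hP : ∀ σ : L →ₐ[K] C, Irreducible (P.map (mapRingHom σ.toRingHom)))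
    {y : (L →ₐ[K] C) → Ω}
    (hy : ∀ σ : L →ₐ[K] C, aeval (y σ) (P.map (mapRingHom σ.toRingHom)) = 0) (w : L)
    (hdeg : P.natDegree ^ Fintype.card (L →ₐ[K] C) ≤
      (minpoly C[X] (∑ σ, algebraMap C Ω (σ w) * y σ)).natDegree) :
    ∃ z : Ω, IsIntegral K[X] z ∧
      Irreducible ((minpoly K[X] z).map (mapRingHom (algebraMap K C))) ∧
      derivative (minpoly K[X] z) ≠ 0 ∧ y (IsScalarTower.toAlgHom K L C) ∈ FL⟮z⟯ := by
  classical
  have : Module.IsTorsionFree C[X] Ω := Module.isTorsionFree_iff_algebraMap_injective.mpr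
    (FaithfulSMul.algebraMap_injective _ _)
  have hKinj : Function.Injective (mapRingHom (algebraMap K C)) :=
    map_injective _ (algebraMap K C).injective
  let s (u : (L →ₐ[K] C) → Ω) : Ω := ∑ σ, algebraMap C Ω (σ w) * u σ
  let T : Finset ((L →ₐ[K] C) → Ω) := Fintype.piFinset fun σ ↦
    ((P.map (mapRingHom σ.toRingHom)).map (algebraMap C[X] Ω)).roots.toFinset
  have hT (u) : u ∈ T ↔ ∀ σ : L →ₐ[K] C, aeval (u σ) (P.map (mapRingHom σ.toRingHom)) = 0 := by
    simp only [T, Fintype.mem_piFinset, Multiset.mem_toFinset]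
    refine forall_congr' fun σ ↦ ?_
    rw [mem_roots ((hm.map _).map _).ne_zero, IsRoot, eval_map_algebraMap]
  have hTcard : T.card ≤ P.natDegree ^ Fintype.card (L →ₐ[K] C) := by
    rw [Fintype.card_piFinset, ← Finset.card_univ]
    refine Finset.prod_le_pow_card _ _ _ fun σ _ ↦ ?_
    refine (Multiset.toFinset_card_le _).trans ((card_roots' _).trans ?_)
    exact natDegree_map_le.trans natDegree_map_le
  have hconj (τ : Ω →+* Ω) (hτ : ∀ q, τ (algebraMap K[X] Ω q) = algebraMap K[X] Ω q) (u)
      (hu : u ∈ T) : ∃ u' ∈ T, τ (s u) = s u' ∧ ∀ σ : L →ₐ[K] C,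
        (∀ x, τ (algebraMap C Ω (σ x)) = algebraMap C Ω (σ x)) → u' σ = τ (u σ) := by
    have hC (c : C) : algebraMap C[X] Ω (Polynomial.C c) = algebraMap C Ω c :=
          (IsScalarTower.algebraMap_apply C C[X] Ω c).symm
    have hK1 (a : K) : algebraMap K Ω a = algebraMap K[X] Ω (Polynomial.C a) := by
      rw [IsScalarTower.algebraMap_apply K C Ω, ← hC, ← hK]
      simp
    have hX : algebraMap C[X] Ω X = algebraMap K[X] Ω X := by
      rw [← hK]
      simp
    have hτK (a : K) : τ (algebraMap K Ω a) = algebraMap K Ω a := by rw [hK1, hτ]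
    obtain ⟨u', h1, h2, h3⟩ := exists_conj_tuple P w (AlgHom.mk τ hτK)
      (by
        change τ (algebraMap C[X] Ω X) = _
        rw [hX, hτ]) u ((hT u).mp hu)
    exact ⟨u', (hT u').mpr h1, h2, h3⟩
  have hyT : y ∈ T := (hT y).mpr hy
  have hy' (σ : L →ₐ[K] C) : aeval (y σ) (derivative (P.map (mapRingHom σ.toRingHom))) ≠ 0 := by
    refine aeval_derivative_ne_zero_of_irreducible (hm.map _) (hP σ) ?_ (hy σ)
    rw [derivative_map, Ne, Polynomial.map_eq_zero_iff (map_injective _ σ.toRingHom.injective)]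
    exact hP'
  have hyint (σ : L →ₐ[K] C) : IsIntegral C[X] (y σ) := ⟨_, hm.map _, hy σ⟩
  have hsint : IsIntegral C[X] (s y) := IsIntegral.sum _ fun σ _ ↦ by
    refine IsIntegral.mul ?_ (hyint σ)
    rw [IsScalarTower.algebraMap_apply C C[X] Ω]
    exact isIntegral_algebraMap
  have hysep (σ : L →ₐ[K] C) : IsSeparable FC (y σ) :=
    isSeparable_of_aeval_derivative_ne_zero
      (p := (P.map (mapRingHom σ.toRingHom)).map (algebraMap C[X] FC))
      (by rw [aeval_map_algebraMap, hy]) (by rw [derivative_map, aeval_map_algebraMap]; exact hy' σ)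
  have hssep : IsSeparable FC (s y) := by
    rw [← mem_separableClosure_iff]
    refine sum_mem fun σ _ ↦ mul_mem ?_ (mem_separableClosure_iff.mpr (hysep σ))
    rw [IsScalarTower.algebraMap_apply C C[X] Ω, IsScalarTower.algebraMap_apply C[X] FC Ω]
    exact _root_.algebraMap_mem _ _
  have hFC {x : Ω} (hx : IsIntegral C[X] x) :
      (minpoly FC x).natDegree = (minpoly C[X] x).natDegree := by
    rw [minpoly.isIntegrallyClosed_eq_field_fractions' FC hx,
      (minpoly.monic hx).natDegree_map]
  have hNT : P.natDegree ^ Fintype.card (L →ₐ[K] C) ≤ (T.image s).card := by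
    refine hdeg.trans ?_
    rw [← hFC hsint]
    refine natDegree_minpoly_le_card hssep _ fun τ ↦ ?_
    obtain ⟨u', hu', h, -⟩ := hconj (τ : Ω →+* Ω) (fun q ↦ by
      rw [← hK, RingHom.comp_apply, IsScalarTower.algebraMap_apply C[X] FC Ω]
      exact τ.commutes _) y hyT
    exact Finset.mem_image.mpr ⟨u', hu', h.symm⟩
  have hinj : Set.InjOn s T := Finset.card_image_iff.mp
    (Finset.card_image_le.antisymm (hTcard.trans hNT))
  have : Module.IsTorsionFree K[X] Ω := Module.isTorsionFree_iff_algebraMap_injective.mpr <| by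
    rw [← hK]
    exact (FaithfulSMul.algebraMap_injective C[X] Ω).comp hKinj
  have hFK {x : Ω} (hx : IsIntegral K[X] x) :
      (minpoly FK x).natDegree = (minpoly K[X] x).natDegree := by
    rw [minpoly.isIntegrallyClosed_eq_field_fractions' FK hx,
      (minpoly.monic hx).natDegree_map]
  let q := ringExpChar FK
  have : ExpChar FK q := inferInstance
  have : ExpChar Ω q := expChar_of_injective_algebraMap (algebraMap FK Ω).injective q
  have : ExpChar FC q := (algebraMap FC Ω).expChar (algebraMap FC Ω).injective q
  obtain ⟨m, hmq⟩ := IsPurelyInseparable.pow_mem (separableClosure FK Ω) q (s y)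
  set z := s y ^ q ^ m with hz
  have hzsep : IsSeparable FK z := by
    obtain ⟨z', hz'⟩ := hmq
    rw [← hz']
    exact mem_separableClosure_iff.mp z'.2
  have hzC : IsIntegral C[X] z := hsint.pow _
  have hzK : IsIntegral K[X] z := isIntegral_polynomial_trans hK hzC
  have hle : (minpoly K[X] z).natDegree ≤ (minpoly C[X] z).natDegree := by
    calc (minpoly K[X] z).natDegree = (minpoly FK z).natDegree := (hFK hzK).symm
      _ ≤ ((T.image s).image (· ^ q ^ m)).card := natDegree_minpoly_le_card hzsep _ fun τ ↦ by
        obtain ⟨u', hu', h, -⟩ := hconj (τ : Ω →+* Ω) (fun q ↦ by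
          rw [IsScalarTower.algebraMap_apply K[X] FK Ω]
          exact τ.commutes _) y hyT
        refine Finset.mem_image.mpr ⟨s u', Finset.mem_image_of_mem _ hu', ?_⟩
        rw [← h, hz]
        exact (map_pow τ _ _).symm
      _ ≤ P.natDegree ^ Fintype.card (L →ₐ[K] C) :=
        Finset.card_image_le.trans (Finset.card_image_le.trans hTcard)
      _ ≤ (minpoly C[X] (s y)).natDegree := hdeg
      _ = (minpoly FC (s y)).natDegree := (hFC hsint).symm
      _ = (minpoly FC z).natDegree := by
        rw [← adjoin.finrank hssep.isIntegral, ← adjoin.finrank (hssep.isIntegral.pow _),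
          ← adjoin_simple_eq_adjoin_pow_expChar_pow_of_isSeparable FC Ω hssep q m]
      _ = (minpoly C[X] z).natDegree := hFC hzC
  have hmK := minpoly.monic hzK
  have hroot : aeval z ((minpoly K[X] z).map (mapRingHom (algebraMap K C))) = 0 := by
    rw [aeval_def, eval₂_map, hK, ← aeval_def, minpoly.aeval]
  have heq : (minpoly K[X] z).map (mapRingHom (algebraMap K C)) = minpoly C[X] z :=
    (eq_of_monic_of_dvd_of_natDegree_le (minpoly.monic hzC) (hmK.map _)
      (minpoly.isIntegrallyClosed_dvd hzC hroot) (by rwa [hmK.natDegree_map]))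
  refine ⟨z, hzK, heq ▸ minpoly.irreducible hzC, fun h ↦ ?_, ?_⟩
  · have h1 : derivative (minpoly FK z) = 0 := by
      rw [minpoly.isIntegrallyClosed_eq_field_fractions' FK hzK, derivative_map, h,
        Polynomial.map_zero]
    have h2 : (minpoly FK z).Separable := hzsep
    exact (separable_iff_derivative_ne_zero (minpoly.irreducible hzsep.isIntegral)).mp h2 h1
  let σ₀ : L →ₐ[K] C := IsScalarTower.toAlgHom K L C
  have hσ₀ : σ₀.toRingHom = algebraMap L C := rfl
  have haeval (p : L[X][X]) : aeval (y σ₀) (p.map (algebraMap L[X] FL)) =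
      aeval (y σ₀) (p.map (mapRingHom σ₀.toRingHom)) := by
    rw [aeval_map_algebraMap, hσ₀, aeval_def, aeval_def, eval₂_map, hL]
  have hysepL : IsSeparable FL (y σ₀) :=
    isSeparable_of_aeval_derivative_ne_zero (p := P.map (algebraMap L[X] FL))
      (by rw [haeval, hy]) (by
        rw [derivative_map, haeval, ← derivative_map]
        exact hy' σ₀)
  suffices y σ₀ ∈ (algebraMap FL⟮z⟯ Ω).range by
    obtain ⟨x, hx⟩ := this
    exact hx ▸ x.2
  refine mem_range_algebraMap_of_forall_algEquiv (hysepL.tower_top _) fun τ ↦ ?_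
  have hτL (p : L[X]) : τ (algebraMap L[X] Ω p) = algebraMap L[X] Ω p := by
    rw [IsScalarTower.algebraMap_apply L[X] FL Ω]
    exact τ.commutes (algebraMap FL FL⟮z⟯ _)
  have hτz : τ z = z := τ.commutes (AdjoinSimple.gen FL z)
  obtain ⟨u', hu', h, h'⟩ := hconj (τ : Ω →+* Ω) (fun p ↦ by
    have : algebraMap K[X] Ω p = algebraMap L[X] Ω (p.map (algebraMap K L)) := by
      rw [← hK, ← hL, RingHom.comp_apply, RingHom.comp_apply, coe_mapRingHom, coe_mapRingHom,
        Polynomial.map_map, ← IsScalarTower.algebraMap_eq]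
    rw [this]
    exact hτL _) y hyT
  have hτs : τ (s y) = s y := by
    apply iterateFrobenius_inj Ω q m
    rw [iterateFrobenius_def, iterateFrobenius_def, ← map_pow]
    exact hτz
  have huy : u' = y := hinj hu' hyT (h.symm.trans hτs)
  refine (h' σ₀ fun x ↦ ?_).symm.trans (congrFun huy σ₀)
  have : algebraMap C Ω (σ₀ x) = algebraMap L[X] Ω (Polynomial.C x) := by
    rw [← hL, RingHom.comp_apply, coe_mapRingHom, map_C, IsScalarTower.algebraMap_apply C C[X] Ω]
    rfl
  rw [this]
  exact hτL _

theorem map_compRingHom_mapRingHom {L C : Type*} [Field L] [Field C] (φ : L →+* C) (t a : L)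
    (g : L[X][X]) : (g.map (compRingHom (Polynomial.C t * X + Polynomial.C a))).map (mapRingHom φ) =
      (g.map (mapRingHom φ)).map
        (compRingHom (Polynomial.C (φ t) * X + Polynomial.C (φ a))) := by
  rw [Polynomial.map_map, Polynomial.map_map]
  congr 1
  refine Polynomial.ringHom_ext (fun c ↦ ?_) ?_ <;> simp

theorem exists_powerSeries_tuple {K L C : Type*} [Field K] [Infinite K] [Field L] [Field C]
    [Algebra K L] [Algebra K C] [FiniteDimensional K L] [IsAlgClosed C] [Fintype (L →ₐ[K] C)]
    [Nonempty (L →ₐ[K] C)] {g : L[X][X]} (hm : g.Monic) (hg' : derivative g ≠ 0)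
    (hg : ∀ σ : L →ₐ[K] C, Irreducible (g.map (mapRingHom σ.toRingHom))) :
    ∃ (a : K) (w t : L) (η : (L →ₐ[K] C) → C⟦X⟧), t ≠ 0 ∧
      (∀ σ : L →ₐ[K] C, aeval (η σ)
        ((g.map (compRingHom (Polynomial.C t * X + Polynomial.C (algebraMap K L a)))).map
          (mapRingHom σ.toRingHom)) = 0) ∧
      g.natDegree ^ Fintype.card (L →ₐ[K] C) ≤
        (minpoly C[X] (∑ σ, PowerSeries.C (σ w) * η σ)).natDegree := by
  have hinj (σ : L →ₐ[K] C) : Function.Injective (mapRingHom σ.toRingHom) :=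
    map_injective _ σ.toRingHom.injective
  have hd (σ : L →ₐ[K] C) : derivative (g.map (mapRingHom σ.toRingHom)) ≠ 0 := by
    rwa [derivative_map, Ne, Polynomial.map_eq_zero_iff (hinj σ)]
  choose r hr0 hr using fun σ ↦ exists_powerSeries_root (hm.map _) (hg σ) (hd σ)
  obtain ⟨a, ha⟩ : ∃ a : K, (∏ σ, r σ).eval (algebraMap K C a) ≠ 0 := by
    by_contra! h
    refine Finset.prod_ne_zero_iff.mpr (fun σ (_ : σ ∈ Finset.univ) ↦ hr0 σ)
      (eq_zero_of_infinite_isRoot _ ((Set.infinite_range_of_injective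
        (algebraMap K C).injective).mono ?_))
    rintro _ ⟨a, rfl⟩
    exact h a
  rw [eval_prod, Finset.prod_ne_zero_iff] at ha
  choose η hη hη1 hη2 using fun σ ↦ hr σ _ (ha σ (Finset.mem_univ σ))
  have hdeg (σ : L →ₐ[K] C) : (g.map (mapRingHom σ.toRingHom)).natDegree = g.natDegree :=
    hm.natDegree_map _
  obtain ⟨w, t, ht, h⟩ := exists_natDegree_minpoly_sum_rescale (fun σ : L →ₐ[K] C ↦ σ)
    Function.injective_id g.natDegree η (fun σ ↦ by rw [← hdeg σ]; exact hη σ) _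
    (fun σ ↦ (hm.map _).map _) hη1 hη2
  refine ⟨a, w, t, _, ht, fun σ ↦ ?_, h⟩
  have ha : σ.toRingHom (algebraMap K L a) = algebraMap K C a := σ.commutes a
  rw [map_compRingHom_mapRingHom, ha]
  refine (aeval_rescale_map_compRingHom _ _ _ _).trans ?_
  rw [hη1, map_zero]

theorem exists_algHom_natDegree_minpoly_eq {R S Ω : Type*} [CommRing R] [IsDomain R]
    [IsIntegrallyClosed R] [CommRing S] [IsDomain S] [Field Ω] [IsAlgClosed Ω] [Algebra R S]
    [Algebra R Ω] [Module.IsTorsionFree R S] [Module.IsTorsionFree R Ω] :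
    ∃ φ : integralClosure R S →ₐ[R] Ω, ∀ x, minpoly R (φ x) = minpoly R (x : S) := by
  refine ⟨IsAlgClosed.lift, fun x ↦ ?_⟩
  have hx : IsIntegral R (x : S) := x.2
  refine minpoly_eq_of_irreducible_of_isIntegrallyClosed (minpoly.monic hx)
    (minpoly.irreducible hx) ?_
  have h : aeval x (minpoly R (x : S)) = 0 := Subtype.ext <| by
    rw [← Subalgebra.aeval_coe, minpoly.aeval, ZeroMemClass.coe_zero]
  rw [aeval_algHom_apply, h, map_zero]

theorem injective_compRingHom {k : Type*} [Field k] {t : k} (ht : t ≠ 0) (a : k) :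
    Function.Injective (compRingHom (C t * X + C a)) := by
  refine (injective_iff_map_eq_zero _).mpr fun p hp ↦ ?_
  refine (comp_eq_zero_iff.mp hp).resolve_right fun h ↦ ht ?_
  simpa using congrArg (fun q : k[X] ↦ q.coeff 1) h.2

theorem isAlgebraic_polynomial_trans {K C Ω : Type*} [Field K] [Field C] [Field Ω]
    [Algebra K C] [Algebra.IsAlgebraic K C] [Algebra K[X] Ω] [Algebra C[X] Ω]
    [FaithfulSMul C[X] Ω]
    (hK : (algebraMap C[X] Ω).comp (mapRingHom (algebraMap K C)) = algebraMap K[X] Ω) {x : Ω}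
    (hx : IsAlgebraic C[X] x) : IsAlgebraic K[X] x := by
  obtain ⟨c, hc, h⟩ := hx.exists_integral_multiple
  have hc' : algebraMap C[X] Ω c ≠ 0 := by
    rwa [Ne, FaithfulSMul.algebraMap_eq_zero_iff]
  have h1 := (isIntegral_polynomial_trans hK h).isAlgebraic
  have h2 := (isIntegral_algebraMap_polynomial hK c).isAlgebraic
  have : x = (algebraMap C[X] Ω c)⁻¹ * (c • x) := by
    rw [Algebra.smul_def, inv_mul_cancel_left₀ hc']
  exact this ▸ h2.inv.mul h1

theorem normal_fractionRing_of_isAlgebraic {R Ω : Type*} [CommRing R] [IsDomain R] [Field Ω]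
    [IsAlgClosed Ω] [Algebra R Ω] (F : Type*) [Field F] [Algebra R F] [IsFractionRing R F]
    [Algebra F Ω] [IsScalarTower R F Ω] (h : ∀ x : Ω, IsAlgebraic R x) : Normal F Ω := by
  have : Algebra.IsAlgebraic F Ω :=
    ⟨fun x ↦ (IsFractionRing.isAlgebraic_iff R F Ω).mp (h x)⟩
  exact normal_iff.mpr fun x ↦ ⟨(Algebra.IsAlgebraic.isAlgebraic x).isIntegral,
    IsAlgClosed.splits _⟩

open IntermediateField in
theorem exists_specialization_cover_aux {K L C Ω : Type*} [Field K] [Infinite K] [Field L]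
    [Field C] [Field Ω] [Algebra K L] [Algebra K C] [Algebra L C] [IsScalarTower K L C]
    [FiniteDimensional K L] [IsAlgClosed C] [Algebra.IsAlgebraic K C] [IsAlgClosed Ω]
    [Algebra K Ω] [Algebra C Ω] [IsScalarTower K C Ω]
    [Algebra K[X] Ω] [Algebra L[X] Ω] [Algebra C[X] Ω] [IsScalarTower C C[X] Ω]
    [FaithfulSMul C[X] Ω] [Algebra.IsAlgebraic C[X] Ω]
    (hK : (algebraMap C[X] Ω).comp (mapRingHom (algebraMap K C)) = algebraMap K[X] Ω)
    (hL : (algebraMap C[X] Ω).comp (mapRingHom (algebraMap L C)) = algebraMap L[X] Ω)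
    {g : L[X][X]} (hm : g.Monic) (hg' : derivative g ≠ 0)
    (hg : ∀ σ : L →ₐ[K] C, Irreducible (g.map (mapRingHom σ.toRingHom))) :
    ∃ (a : K) (t : L) (q : K[X][X]) (r : L[X]), t ≠ 0 ∧ q.Monic ∧
      Irreducible (q.map (mapRingHom (algebraMap K C))) ∧ derivative q ≠ 0 ∧ r ≠ 0 ∧
      ∀ (x : L) (c : C), r.eval x ≠ 0 →
        eval₂ ((algebraMap L C).comp (evalRingHom x)) c (q.map (mapRingHom (algebraMap K L))) = 0 →
        (minpoly L c).natDegree = q.natDegree →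
        ∃ b ∈ L⟮c⟯, eval₂ ((algebraMap L C).comp (evalRingHom x)) b
          (g.map (compRingHom (Polynomial.C t * X + Polynomial.C (algebraMap K L a)))) = 0 ∧
          g.natDegree ≤ (minpoly L b).natDegree := by
  have : Fintype (L →ₐ[K] C) := Fintype.ofFinite _
  have : Nonempty (L →ₐ[K] C) := ⟨IsScalarTower.toAlgHom K L C⟩
  have : Module.IsTorsionFree C[X] Ω := Module.isTorsionFree_iff_algebraMap_injective.mpr
    (FaithfulSMul.algebraMap_injective _ _)
  have : FaithfulSMul K[X] Ω := (faithfulSMul_iff_algebraMap_injective _ _).mpr <| by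
    rw [← hK]
    exact (FaithfulSMul.algebraMap_injective C[X] Ω).comp
      (map_injective _ (algebraMap K C).injective)
  have : FaithfulSMul L[X] Ω := (faithfulSMul_iff_algebraMap_injective _ _).mpr <| by
    rw [← hL]
    exact (FaithfulSMul.algebraMap_injective C[X] Ω).comp
      (map_injective _ (algebraMap L C).injective)
  have : Module.IsTorsionFree L[X] Ω := Module.isTorsionFree_iff_algebraMap_injective.mpr
    (FaithfulSMul.algebraMap_injective _ _)
  have : Algebra.IsAlgebraic L C := Algebra.IsAlgebraic.tower_top (K := K) L
  have : Normal K C := normal_iff.mpr fun x ↦ ⟨(Algebra.IsAlgebraic.isAlgebraic x).isIntegral,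
    IsAlgClosed.splits _⟩
  let := FractionRing.liftAlgebra K[X] Ω
  let := FractionRing.liftAlgebra L[X] Ω
  let := FractionRing.liftAlgebra C[X] Ω
  have := FractionRing.isScalarTower_liftAlgebra K[X] Ω
  have := FractionRing.isScalarTower_liftAlgebra L[X] Ω
  have := FractionRing.isScalarTower_liftAlgebra C[X] Ω
  have halg (x : Ω) : IsAlgebraic C[X] x := Algebra.IsAlgebraic.isAlgebraic x
  have := normal_fractionRing_of_isAlgebraic (FractionRing C[X]) halg
  have := normal_fractionRing_of_isAlgebraic (FractionRing K[X])
    fun x : Ω ↦ isAlgebraic_polynomial_trans hK (halg x)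
  have := normal_fractionRing_of_isAlgebraic (FractionRing L[X])
    fun x : Ω ↦ isAlgebraic_polynomial_trans hL (halg x)
  obtain ⟨a, w, t, η, ht, hη, hdeg⟩ := exists_powerSeries_tuple hm hg' hg
  set P := g.map (compRingHom (Polynomial.C t * X + Polynomial.C (algebraMap K L a))) with hPdef
  have hPm : P.Monic := hm.map _
  have : Module.IsTorsionFree C[X] C⟦X⟧ := Module.isTorsionFree_iff_algebraMap_injective.mpr
    (Polynomial.coe_injective C)
  obtain ⟨φ, hφ⟩ := exists_algHom_natDegree_minpoly_eq (R := C[X]) (S := C⟦X⟧) (Ω := Ω)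
  let y₀ (σ : L →ₐ[K] C) : integralClosure C[X] C⟦X⟧ := ⟨η σ, _, hPm.map _, hη σ⟩
  have hy (σ : L →ₐ[K] C) : aeval (φ (y₀ σ)) (P.map (mapRingHom σ.toRingHom)) = 0 := by
    have h : aeval (y₀ σ) (P.map (mapRingHom σ.toRingHom)) = 0 := Subtype.ext <| by
      rw [← Subalgebra.aeval_coe, ZeroMemClass.coe_zero]
      exact hη σ
    rw [aeval_algHom_apply, h, map_zero]
  have hsum : minpoly C[X] (∑ σ, algebraMap C Ω (σ w) * φ (y₀ σ)) =
      minpoly C[X] (∑ σ, PowerSeries.C (σ w) * η σ) := by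
    have h1 : ∑ σ, algebraMap C Ω (σ w) * φ (y₀ σ) =
        φ (∑ σ, algebraMap C[X] _ (Polynomial.C (σ w)) * y₀ σ) := by
      rw [map_sum]
      refine Finset.sum_congr rfl fun σ _ ↦ ?_
      rw [map_mul, AlgHom.commutes, IsScalarTower.algebraMap_apply C C[X] Ω]
      rfl
    rw [h1, hφ]
    congr 1
    rw [AddSubmonoidClass.coe_finsetSum]
    refine Finset.sum_congr rfl fun σ _ ↦ ?_
    rw [MulMemClass.coe_mul]
    congr 1
    exact Polynomial.coe_C _
  have hmapP (σ : L →ₐ[K] C) : Irreducible (P.map (mapRingHom σ.toRingHom)) := by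
    rw [hPdef, map_compRingHom_mapRingHom]
    exact irreducible_map_compRingHom (hg σ) ((map_ne_zero σ.toRingHom).mpr ht) _
  have hPdeg : P.natDegree = g.natDegree := hm.natDegree_map _
  have hP' : derivative P ≠ 0 := by
    rwa [hPdef, derivative_map, Ne, Polynomial.map_eq_zero_iff (injective_compRingHom ht _)]
  obtain ⟨z, hz, hirr, hz', hyz⟩ := exists_separable_generator (FK := FractionRing K[X])
    (FL := FractionRing L[X]) (FC := FractionRing C[X]) hK hL hPm hP' hmapP hy w
    (by rw [hsum, hPdeg]; exact hdeg)
  set σ₀ : L →ₐ[K] C := IsScalarTower.toAlgHom K L C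
  have hσ₀ : mapRingHom σ₀.toRingHom = mapRingHom (algebraMap L C) := rfl
  have hzL : IsIntegral L[X] z := by
    refine ⟨(minpoly K[X] z).map (mapRingHom (algebraMap K L)), (minpoly.monic hz).map _, ?_⟩
    rw [eval₂_map, ← hL, RingHom.comp_assoc, mapRingHom_comp, ← IsScalarTower.algebraMap_eq, hK]
    exact minpoly.aeval _ _
  have hminz : minpoly L[X] z = (minpoly K[X] z).map (mapRingHom (algebraMap K L)) := by
    refine minpoly_eq_of_irreducible_of_isIntegrallyClosed ((minpoly.monic hz).map _) ?_ ?_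
    · refine ((minpoly.monic hz).map _).irreducible_of_irreducible_map
        (mapRingHom (algebraMap L C)) _ ?_
      rwa [Polynomial.map_map, mapRingHom_comp, ← IsScalarTower.algebraMap_eq]
    · rw [aeval_def, eval₂_map, ← hL, RingHom.comp_assoc, mapRingHom_comp,
        ← IsScalarTower.algebraMap_eq, hK]
      exact minpoly.aeval _ _
  have haeval (p : L[X][X]) (u : Ω) :
      aeval u (p.map (mapRingHom (algebraMap L C))) = aeval u p := by
    rw [aeval_def, eval₂_map, hL, ← aeval_def]
  have hyL : aeval (φ (y₀ σ₀)) P = 0 := by rw [← haeval, ← hσ₀, hy]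
  have hyLint : IsIntegral L[X] (φ (y₀ σ₀)) := ⟨P, hPm, hyL⟩
  obtain ⟨r, hr, h⟩ := exists_specialization (E := C) hzL hyz P hyL
  have hydeg : g.natDegree ≤ (minpoly (FractionRing L[X]) (φ (y₀ σ₀))).natDegree := by
    have hmy := minpoly.monic hyLint
    rw [minpoly.isIntegrallyClosed_eq_field_fractions' (FractionRing L[X]) hyLint,
      hmy.natDegree_map, ← hPdeg, ← hPm.natDegree_map (mapRingHom σ₀.toRingHom),
      ← hmy.natDegree_map (mapRingHom (algebraMap L C)),
      ← minpoly_eq_of_irreducible_of_isIntegrallyClosed (hPm.map _) (hmapP σ₀) (hy σ₀)]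
    refine natDegree_le_of_dvd (minpoly.isIntegrallyClosed_dvd ⟨_, hPm.map _, hy σ₀⟩ ?_)
      (hmy.map _).ne_zero
    rw [haeval, minpoly.aeval]
  refine ⟨a, t, minpoly K[X] z, r, ht, minpoly.monic hz, hirr, hz', hr, fun x c hx hc hdc ↦ ?_⟩
  rw [← hminz] at hc
  obtain ⟨b, hb, hb', hb''⟩ := h x c hx hc (by
    rw [hdc, hminz, (minpoly.monic hz).natDegree_map])
  exact ⟨b, hb, hb', hydeg.trans hb''⟩

open IntermediateField in
theorem exists_specialization_cover {K L C : Type*} [Field K] [Infinite K] [Field L]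
    [Field C] [Algebra K L] [Algebra K C] [Algebra L C] [IsScalarTower K L C]
    [FiniteDimensional K L] [IsAlgClosed C] [Algebra.IsAlgebraic K C]
    {g : L[X][X]} (hm : g.Monic) (hg' : derivative g ≠ 0)
    (hg : ∀ σ : L →ₐ[K] C, Irreducible (g.map (mapRingHom σ.toRingHom))) :
    ∃ (a : K) (t : L) (q : K[X][X]) (r : L[X]), t ≠ 0 ∧ q.Monic ∧
      Irreducible (q.map (mapRingHom (algebraMap K C))) ∧ derivative q ≠ 0 ∧ r ≠ 0 ∧
      ∀ (x : L) (c : C), r.eval x ≠ 0 →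
        eval₂ ((algebraMap L C).comp (evalRingHom x)) c (q.map (mapRingHom (algebraMap K L))) = 0 →
        (minpoly L c).natDegree = q.natDegree →
        ∃ b ∈ L⟮c⟯, eval₂ ((algebraMap L C).comp (evalRingHom x)) b
          (g.map (compRingHom (Polynomial.C t * X + Polynomial.C (algebraMap K L a)))) = 0 ∧
          g.natDegree ≤ (minpoly L b).natDegree := by
  let Ω := AlgebraicClosure (FractionRing C[X])
  let : Algebra K[X] Ω :=
    ((algebraMap C[X] Ω).comp (mapRingHom (algebraMap K C))).toAlgebra
  let : Algebra L[X] Ω :=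
    ((algebraMap C[X] Ω).comp (mapRingHom (algebraMap L C))).toAlgebra
  have : Algebra.IsAlgebraic C[X] Ω :=
    ⟨fun x ↦ (IsFractionRing.isAlgebraic_iff C[X] (FractionRing C[X]) Ω).mpr
      (Algebra.IsAlgebraic.isAlgebraic x)⟩
  have : FaithfulSMul C[X] Ω := (faithfulSMul_iff_algebraMap_injective _ _).mpr <| by
    rw [IsScalarTower.algebraMap_eq C[X] (FractionRing C[X]) Ω]
    exact (algebraMap (FractionRing C[X]) Ω).injective.comp
      (IsFractionRing.injective C[X] (FractionRing C[X]))
  exact exists_specialization_cover_aux (Ω := Ω) rfl rfl hm hg' hg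

theorem irreducible_map_algHom {K L C : Type*} [Field K] [Field L] [Field C] [Algebra K L]
    [Algebra K C] [Algebra L C] [IsScalarTower K L C] [FiniteDimensional K L] [IsAlgClosed C]
    [Algebra.IsAlgebraic K C] {f : L[X][X]} (hf : Irreducible (f.map (mapRingHom (algebraMap L C))))
    (σ : L →ₐ[K] C) : Irreducible (f.map (mapRingHom σ.toRingHom)) := by
  have : Algebra.IsAlgebraic L C := Algebra.IsAlgebraic.tower_top (K := K) L
  have : Normal K C := normal_iff.mpr fun x ↦ ⟨(Algebra.IsAlgebraic.isAlgebraic x).isIntegral,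
    IsAlgClosed.splits _⟩
  let s : C ≃ₐ[K] C := AlgEquiv.ofBijective (σ.liftNormal C) (AlgHom.normal_bijective K C C _)
  have hs (x : L) : s (algebraMap L C x) = σ x := σ.liftNormal_commutes C x
  have h := (MulEquiv.irreducible_iff (mapEquiv (mapEquiv s.toRingEquiv))).mpr hf
  convert h
  rw [mapEquiv_apply, Polynomial.map_map]
  congr 1
  refine Polynomial.ringHom_ext (fun c ↦ ?_) ?_
  · simpa using (hs c).symm
  · simp

theorem IsFullyHilbertian.infinite {K : Type} [Field K] (hK : IsFullyHilbertian K) :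
    Infinite K := by
  by_contra hfin
  rw [not_infinite_iff_finite] at hfin
  have hirr : Irreducible (C X * X + C 1 : (AlgebraicClosure K)[X][X]) :=
    irreducible_C_mul_X_add_C X_ne_zero isRelPrime_one_right
  obtain ⟨A, -, hA, hcard, -⟩ := hK (C X * X + C 1) (by simpa using hirr) (by simp)
  have hmem : (0 : K) ∈ A := by
    have : A = Set.univ := Set.eq_of_subset_of_ncard_le (Set.subset_univ A) (by
      rw [Set.ncard_univ, ← Nat.card_coe_set_eq, Nat.card, Nat.card, hcard]) Set.finite_univ
    exact this ▸ Set.mem_univ _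
  have h : Irreducible ((C X * X + C 1 : K[X][X]).map (evalRingHom 0)) := hA hmem
  simp at h

open IntermediateField in
theorem IsFullyHilbertian.exists_linearDisjoint {K C : Type} [Field K] [Field C] [Algebra K C]
    [IsAlgClosure K C] (hK : IsFullyHilbertian K) {q : K[X][X]}
    (hq : Irreducible (q.map (mapRingHom (algebraMap K C)))) (hq' : derivative q ≠ 0) :
    ∃ (A : Set K) (c : A → C), A ⊆ HilbertSet q ∧ Cardinal.mk A = Cardinal.mk K ∧
      (∀ a : A, aeval (c a) (q.map (evalRingHom (a : K))) = 0) ∧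
      ∀ a, (K⟮c a⟯).LinearDisjoint (adjoin K (c '' {a' | a' ≠ a})) := by
  let e : AlgebraicClosure K ≃ₐ[K] C := IsAlgClosure.equiv K _ _
  obtain ⟨A, b, hA, hcard, hb, hdisj⟩ := hK q (by
    have h := (MulEquiv.irreducible_iff (mapEquiv (mapEquiv e.symm.toRingEquiv))).mpr hq
    convert h
    rw [mapEquiv_apply, Polynomial.map_map]
    congr 1
    refine Polynomial.ringHom_ext (fun c ↦ ?_) ?_
    · simp
    · simp) hq'
  refine ⟨A, fun a ↦ e (b a), hA, hcard, fun a ↦ ?_, fun a ↦ ?_⟩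
  · exact (aeval_algHom_apply e.toAlgHom _ _).trans (by rw [hb, map_zero])
  · have h := (hdisj a).map e.toAlgHom
    rw [adjoin_map, Set.image_singleton] at h
    refine h.of_le le_rfl ?_
    rw [adjoin_le_iff]
    rintro _ ⟨a', ha', rfl⟩
    refine ⟨b a', ?_, rfl⟩
    exact (le_iSup₂_of_le (f := fun (a' : A) (_ : a' ≠ a) ↦ adjoin K {b a'}) a' ha' le_rfl)
      (mem_adjoin_simple_self K _)

open IntermediateField in
theorem exists_root_of_eval_integralNormalization {L C : Type*} [Field L] [Field C] [Algebra L C]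
    {f : L[X][X]} (hf : 1 ≤ f.natDegree) {α : L} (hα : f.leadingCoeff.eval α ≠ 0) {b : C}
    (hb : eval₂ ((algebraMap L C).comp (evalRingHom α)) b f.integralNormalization = 0)
    (hdeg : f.natDegree ≤ (minpoly L b).natDegree) :
    ∃ β ∈ L⟮b⟯, aeval β (f.map (evalRingHom α)) = 0 ∧ Irreducible (f.map (evalRingHom α)) := by
  have hα' : evalRingHom α f.leadingCoeff ≠ 0 := hα
  have hdegh : (f.map (evalRingHom α)).natDegree = f.natDegree :=
    natDegree_map_eq_iff.mpr (.inl hα')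
  rw [← eval₂_map, ← integralNormalization_map _ _ hα', ← aeval_def] at hb
  set h := f.map (evalRingHom α) with hh
  have hlc : algebraMap L C h.leadingCoeff ≠ 0 := by
    rw [hh, leadingCoeff_map_of_leadingCoeff_ne_zero _ hα']
    simpa using hα'
  set β := (algebraMap L C h.leadingCoeff)⁻¹ * b with hβ
  have hb' : b = algebraMap L C h.leadingCoeff * β := by rw [hβ, mul_inv_cancel_left₀ hlc]
  have hroot : aeval β h = 0 := by
    have := integralNormalization_eval₂_leadingCoeff_mul (hdegh ▸ hf : 1 ≤ h.natDegree)
      (algebraMap L C) β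
    rw [← hb', ← aeval_def, hb] at this
    exact (mul_eq_zero.mp this.symm).resolve_left (pow_ne_zero _ hlc)
  have h0 : h ≠ 0 := fun h0 ↦ by simp [h0] at hlc
  have h_int : IsIntegral L β := isAlgebraic_iff_isIntegral.mp ⟨h, h0, hroot⟩
  have hbint : IsIntegral L b := hb' ▸ isIntegral_algebraMap.mul h_int
  have hadj : L⟮b⟯ = L⟮β⟯ := by
    apply le_antisymm <;> rw [adjoin_simple_le_iff]
    · rw [hb']
      exact mul_mem (_root_.algebraMap_mem _ _) (mem_adjoin_simple_self L β)
    · exact mul_mem (inv_mem (_root_.algebraMap_mem _ _)) (mem_adjoin_simple_self L b)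
  refine ⟨β, hadj ▸ mem_adjoin_simple_self L β, hroot, ?_⟩
  rw [← adjoin.finrank hbint, hadj, adjoin.finrank h_int] at hdeg
  obtain ⟨u, hu⟩ := minpoly.dvd L β hroot
  have hu0 : u ≠ 0 := fun h ↦ h0 (by rw [hu, h, mul_zero])
  have hdegu : u.natDegree = 0 := by
    have := natDegree_mul (minpoly.ne_zero h_int) hu0
    rw [← hu, hdegh] at this
    lia
  have hunit : IsUnit u := by
    rw [eq_C_of_natDegree_eq_zero hdegu] at hu0 ⊢
    exact isUnit_C.mpr (isUnit_iff_ne_zero.mpr fun h ↦ hu0 (by rw [h, C_0]))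
  rw [hu, irreducible_mul_isUnit hunit]
  exact minpoly.irreducible h_int

theorem irreducible_map_integralNormalization {K L C : Type*} [Field K] [Field L] [Field C]
    [Algebra K L] [Algebra K C] [Algebra L C] [IsScalarTower K L C] [FiniteDimensional K L]
    [IsAlgClosed C] [Algebra.IsAlgebraic K C] {f : L[X][X]} (hf' : derivative f ≠ 0)
    (hf : Irreducible (f.map (mapRingHom (algebraMap L C)))) (σ : L →ₐ[K] C) :
    Irreducible (f.integralNormalization.map (mapRingHom σ.toRingHom)) := by
  have hinj : Function.Injective (mapRingHom σ.toRingHom) := map_injective _ σ.toRingHom.injective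
  have hf0 : f ≠ 0 := fun h ↦ hf' (by rw [h, derivative_zero])
  have hdeg : f.natDegree ≠ 0 := fun h ↦ hf' (derivative_of_natDegree_zero h)
  rw [← integralNormalization_map _ _ ((map_ne_zero_iff _ hinj).mpr (leadingCoeff_ne_zero.mpr hf0))]
  have : Nonempty (NormalizedGCDMonoid C[X]) := inferInstance
  let := this.some
  exact irreducible_integralNormalization (irreducible_map_algHom hf σ)
    (by rwa [natDegree_map_eq_of_injective hinj])

theorem Cardinal.mk_sdiff_eq_of_finite {α : Type*} {A B : Set α} (hA : A.Infinite)
    (hB : B.Finite) : Cardinal.mk ↑(A \ B) = Cardinal.mk A := by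
  have hinf : Infinite A := hA.to_subtype
  refine le_antisymm (Cardinal.mk_le_mk_of_subset Set.sdiff_subset) ?_
  have h1 : Cardinal.mk A ≤ Cardinal.mk ↑(A \ B) + Cardinal.mk B :=
    (Cardinal.mk_le_mk_of_subset (by simp)).trans (Cardinal.mk_union_le (A \ B) B)
  have h2 : Cardinal.aleph0 ≤ Cardinal.mk ↑(A \ B) :=
    Cardinal.aleph0_le_mk_iff.mpr (hA.sdiff hB).to_subtype
  rwa [Cardinal.add_eq_left h2 ((Cardinal.lt_aleph0_iff_set_finite.mpr hB).le.trans h2)] at h1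

theorem finite_setOf_eval_eq_zero {K L : Type*} [Field K] [Field L] {p : L[X]} (hp : p ≠ 0)
    {φ : K → L} (hφ : Function.Injective φ) : {x : K | p.eval (φ x) = 0}.Finite :=
  (finite_setOfPred_isRoot hp).preimage hφ.injOn

/-- A finite extension of a fully Hilbertian field is fully
Hilbertian. -/
theorem finite_extension_isFullyHilbertian
    (K L : Type) [Field K] [Field L] [Algebra K L] [FiniteDimensional K L]
    (hK : IsFullyHilbertian K) :
    IsFullyHilbertian L := by
  intro f hf hf'
  have : Infinite K := hK.infinite
  have : Algebra.IsAlgebraic K (AlgebraicClosure L) := Algebra.IsAlgebraic.trans K L _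
  have : IsAlgClosure K (AlgebraicClosure L) := ⟨inferInstance, inferInstance⟩
  have hf0 : f ≠ 0 := fun h ↦ hf' (by rw [h, derivative_zero])
  have hdegf : 1 ≤ f.natDegree :=
    Nat.one_le_iff_ne_zero.mpr fun h ↦ hf' (derivative_of_natDegree_zero h)
  obtain ⟨a, t, q, r, ht, hqm, hq, hq', hr, hspec⟩ := exists_specialization_cover (K := K)
    (monic_integralNormalization hf0) (derivative_integralNormalization_ne_zero hf')
    (irreducible_map_integralNormalization hf' hf)
  obtain ⟨A, c, hA, hcard, hc, hdisj⟩ := hK.exists_linearDisjoint hq hq'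
  obtain ⟨S, hS⟩ := exists_finset_linearDisjoint_of_finiteDimensional (L := L) c hdisj
  let φ (x : K) : L := t * algebraMap K L x + algebraMap K L a
  have hφ : Function.Injective φ := fun x x' h ↦
    (algebraMap K L).injective (mul_left_cancel₀ ht (add_right_cancel h))
  let B : Set K := (↑) '' (S : Set A) ∪ ({x | r.eval (algebraMap K L x) = 0} ∪
    {x | f.leadingCoeff.eval (φ x) = 0})
  have hB : B.Finite := (S.finite_toSet.image _).union
    ((finite_setOf_eval_eq_zero hr (algebraMap K L).injective).union
      (finite_setOf_eval_eq_zero (leadingCoeff_ne_zero.mpr hf0) hφ))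
  have hroot (x : ↑(A \ B)) : ∃ β ∈ IntermediateField.adjoin L {c ⟨x, x.2.1⟩},
      aeval β (f.map (evalRingHom (φ x))) = 0 ∧ Irreducible (f.map (evalRingHom (φ x))) := by
    obtain ⟨x, hx, hxB⟩ := x
    simp only [B, Set.mem_union, not_or] at hxB
    obtain ⟨hxS, hxr, hxf⟩ := hxB
    have hcx : aeval (c ⟨x, hx⟩) (q.map (evalRingHom x)) = 0 := hc ⟨x, hx⟩
    have hqx : Irreducible (q.map (evalRingHom x)) := hA hx
    have hxS' : ⟨x, hx⟩ ∉ S := fun h ↦ hxS ⟨_, h, rfl⟩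
    obtain ⟨b, hb, hb', hbdeg⟩ := hspec (algebraMap K L x) (c ⟨x, hx⟩) hxr (by
      rw [eval₂_map]
      rw [aeval_def, eval₂_map] at hcx
      convert hcx using 2
      refine Polynomial.ringHom_ext (fun y ↦ ?_) ?_
      · simp [IsScalarTower.algebraMap_apply K L (AlgebraicClosure L)]
      · simp [IsScalarTower.algebraMap_apply K L (AlgebraicClosure L)]) (by
      rw [(hS _ hxS').1, ← minpoly.eq_of_irreducible_of_monic hqx hcx (hqm.map _),
        hqm.natDegree_map])
    rw [natDegree_integralNormalization] at hbdeg
    obtain ⟨β, hβ, h⟩ := exists_root_of_eval_integralNormalization hdegf (α := φ x) hxf (b := b) (by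
      rw [eval₂_map] at hb'
      convert hb' using 2
      refine Polynomial.ringHom_ext (fun y ↦ ?_) ?_
      · simp
      · simp [φ]) hbdeg
    exact ⟨β, (IntermediateField.adjoin_simple_le_iff.mpr hb) hβ, h⟩
  choose β hβ hβ' hirr using hroot
  let e : ↑(A \ B) ≃ ↑(φ '' (A \ B)) := Equiv.Set.image φ (A \ B) hφ
  have hAinf : A.Infinite := by
    rw [← Set.infinite_coe_iff, ← Cardinal.aleph0_le_mk_iff, hcard]
    exact Cardinal.aleph0_le_mk K
  refine ⟨φ '' (A \ B), fun α ↦ β (e.symm α), ?_, ?_, fun α ↦ ?_, fun α ↦ ?_⟩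
  · rintro _ ⟨x, hx, rfl⟩
    exact hirr ⟨x, hx⟩
  · rw [Cardinal.mk_image_eq hφ, Cardinal.mk_sdiff_eq_of_finite hAinf hB, hcard]
    exact (Cardinal.mk_le_of_injective (algebraMap K L).injective).antisymm
      ((Algebra.IsAlgebraic.cardinalMk_le_max K L).trans
        (max_le le_rfl (Cardinal.aleph0_le_mk K)))
  · obtain ⟨x, rfl⟩ := e.surjective α
    beta_reduce
    rw [e.symm_apply_apply]
    exact hβ' x
  · obtain ⟨x, rfl⟩ := e.surjective α
    beta_reduce
    rw [e.symm_apply_apply]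
    have hxS : (⟨x, x.2.1⟩ : A) ∉ S := fun h ↦ x.2.2 (.inl ⟨_, h, rfl⟩)
    refine (hS _ hxS).2.of_le (IntermediateField.adjoin_simple_le_iff.mpr (hβ x))
      (iSup₂_le fun α' hα' ↦ ?_)
    obtain ⟨x', rfl⟩ := e.surjective α'
    rw [e.symm_apply_apply, IntermediateField.adjoin_simple_le_iff]
    have hne : (⟨x', x'.2.1⟩ : A) ≠ ⟨x, x.2.1⟩ := fun h ↦
      hα' (congrArg e (Subtype.ext (congrArg (fun y : A ↦ (y : K)) h)))
    exact IntermediateField.adjoin_simple_le_iff.mpr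
      (IntermediateField.subset_adjoin L _ (Set.mem_image_of_mem c hne)) (hβ x')
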